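/- arXiv:2005.01342 — 2 statements merged into one kernel-verified Lean document; each statement's English description precedes it below -/
import Mathlib

section
/- Let 𝒯 be a simple streaming string transducer computing a function f such that |f| : w ↦ |f(w)| has (k+1)-polynomial growth. Then there exist B ≥ 0 and a (k,B)-bounded streaming string transducer computing the same function f. -/
set_option autoImplicit false

/-! ### Asymptotic growth of functions `A* → ℕ` -/

/-- `g` has `k`-polynomial growth: `g(w) = O(|w|^k)` and there is an infinite set `L`
of words on which `g(w) = Ω(|w|^k)`. -/
def PolyGrowth {A : Type} (g : List A → ℕ) (k : ℕ) : Prop :=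
  (∃ C : ℕ, ∀ w, g w ≤ C * w.length ^ k + C) ∧
  (∃ L : Set (List A), L.Infinite ∧ ∃ c : ℕ, 0 < c ∧ ∀ w ∈ L, w.length ^ k ≤ c * g w)

/-- `g` has exponential growth: `g(w) = 2^{O(|w|)}` and there is an infinite set `L`
of words on which `g(w) = 2^{Ω(|w|)}`. -/
def ExpGrowth {A : Type} (g : List A → ℕ) : Prop :=
  (∃ C : ℕ, ∀ w, g w ≤ 2 ^ (C * w.length + C)) ∧
  (∃ L : Set (List A), L.Infinite ∧ ∃ c : ℕ, 0 < c ∧ ∀ w ∈ L, 2 ^ w.length ≤ (g w) ^ c)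

/-! ### Substitutions -/

/-- Extension of a substitution `s : X → (B ⊎ X)*` to a morphism on `(B ⊎ X)*`
fixing the letters of `B`; this also gives the composition of substitutions,
`(s₁ ∘ s₂) x = applySubst s₁ (s₂ x)`. -/
def applySubst {B X : Type} (s : X → List (B ⊕ X)) (l : List (B ⊕ X)) : List (B ⊕ X) :=
  l.flatMap (fun c => match c with | Sum.inl b => [Sum.inl b] | Sum.inr x => s x)

/-- Evaluation of a word over `B ⊎ X` under a valuation `v : X → B*` of the registers. -/
def evalSubst {B X : Type} (v : X → List B) (l : List (B ⊕ X)) : List B :=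
  l.flatMap (fun c => match c with | Sum.inl b => [b] | Sum.inr x => v x)

/-- Number of occurrences of register `x` in a word over `B ⊎ X`. -/
noncomputable def occCount {B X : Type} (x : X) (l : List (B ⊕ X)) : ℕ :=
  l.countP (fun c => @decide (c = Sum.inr x) (Classical.propDecidable _))

/-- Total number of occurrences of register `x` in the whole set of words `{s y | y ∈ X}`. -/
noncomputable def totalOcc {B X : Type} [Fintype X] (s : X → List (B ⊕ X)) (x : X) : ℕ :=
  ∑ y : X, occCount x (s y)

/-! ### Streaming string transducers -/

/-- A streaming string transducer (SST) with input alphabet `A` and output alphabet `B`: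
finitely many states `Q` with initial state `q0`, finitely many registers `X` with
initial contents `init`, a partial transition/update function (`trans`, returning the
successor state together with the register update substitution, with a common domain),
and a partial output function `out`. -/
structure SST (A B : Type) where
  Q : Type
  X : Type
  [finQ : Fintype Q]
  [finX : Fintype X]
  q0 : Q
  init : X → List B
  trans : Q → A → Option (Q × (X → List (B ⊕ X)))
  out : Q → Option (List (B ⊕ X))

attribute [instance] SST.finQ SST.finX

/-- Run of an SST from state `q` with current register valuation `v`. -/
def SST.runFrom {A B : Type} (T : SST A B) :
    T.Q → (T.X → List B) → List A → Option (T.Q × (T.X → List B))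
  | q, v, [] => some (q, v)
  | q, v, a :: w =>
    match T.trans q a with
    | none => none
    | some (q', s) => T.runFrom q' (fun x => evalSubst v (s x)) w

/-- The (partial) function computed by an SST. -/
def SST.eval {A B : Type} (T : SST A B) (w : List A) : Option (List B) :=
  (T.runFrom T.q0 T.init w).bind fun p => (T.out p.1).map fun o => evalSubst p.2 o

def SST.Computes {A B : Type} (T : SST A B) (f : List A → Option (List B)) : Prop :=
  ∀ w, T.eval w = f w

/-- An SST is copyless if every update substitution uses each register at most once
in total. -/
def SST.Copyless {A B : Type} (T : SST A B) : Prop :=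
  ∀ q a p, T.trans q a = some p → ∀ x : T.X, totalOcc p.2 x ≤ 1

/-- An SST is `k`-layered if its registers can be partitioned into layers
`X_0, …, X_k` such that every update of a register of layer `i` only uses registers
of layers `≤ i`, and each register of layer `i` is used at most once in total in the
updates of the registers of layer `i`. -/
def SST.IsLayered {A B : Type} (T : SST A B) (k : ℕ) : Prop :=
  ∃ layer : T.X → Fin (k + 1),
    ∀ q a p, T.trans q a = some p →
      (∀ x y, Sum.inr y ∈ p.2 x → layer y ≤ layer x) ∧
      (∀ y : T.X,
        (∑ x ∈ Finset.univ.filter (fun x => layer x = layer y), occCount y (p.2 x)) ≤ 1)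

/-- The composed substitution `λ(q, w)` applied along the run reading `w` from state `q`
(together with the state reached). -/
def SST.substFrom {A B : Type} (T : SST A B) :
    T.Q → List A → Option (T.Q × (T.X → List (B ⊕ T.X)))
  | q, [] => some (q, fun x => [Sum.inr x])
  | q, a :: w =>
    match T.trans q a with
    | none => none
    | some (q', s) => (T.substFrom q' w).map fun p => (p.1, fun x => applySubst s (p.2 x))

/-- An SST is `(k,B)`-bounded if its registers can be partitioned into layers
`X_0, …, X_k` such that every update of a register of layer `i` only uses registers of
layers `≤ i`, and for every state `q` and word `w`, each register of layer `i` occurs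
at most `B` times in total in `{λ(q,w)(x) | x ∈ X_i}`. -/
def SST.IsBounded {A B : Type} (T : SST A B) (k Bd : ℕ) : Prop :=
  ∃ layer : T.X → Fin (k + 1),
    (∀ q a p, T.trans q a = some p → ∀ x y, Sum.inr y ∈ p.2 x → layer y ≤ layer x) ∧
    (∀ q w p, T.substFrom q w = some p →
      ∀ y : T.X,
        (∑ x ∈ Finset.univ.filter (fun x => layer x = layer y), occCount y (p.2 x)) ≤ Bd)

/-! ### Simple SSTs -/

/-- A simple SST: total, a single state (hence no state component), and update
substitutions and output using no letters of `B`. -/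
structure SimpleSST (A B : Type) where
  X : Type
  [finX : Fintype X]
  [decX : DecidableEq X]
  init : X → List B
  upd : A → X → List X
  out : List X

attribute [instance] SimpleSST.finX SimpleSST.decX

/-- Register valuation of a simple SST after reading a word, starting from valuation `v`. -/
def SimpleSST.valFrom {A B : Type} (T : SimpleSST A B) :
    (T.X → List B) → List A → T.X → List B
  | v, [] => v
  | v, a :: w => T.valFrom (fun x => (T.upd a x).flatMap v) w

/-- Register valuation `𝒯^w` of a simple SST after reading `w`. -/
def SimpleSST.val {A B : Type} (T : SimpleSST A B) (w : List A) : T.X → List B :=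
  T.valFrom T.init w

/-- The (total) function computed by a simple SST. -/
def SimpleSST.eval {A B : Type} (T : SimpleSST A B) (w : List A) : List B :=
  (T.out).flatMap (T.val w)

/-! ### Two-way transducers -/

/-- A tape symbol: a letter of `A` or one of the two endmarkers `⊢`, `⊣`. -/
inductive TapeSym (A : Type) where
  | lend
  | rend
  | letter (a : A)

/-- The content of the tape `⊢w⊣` at position `m ∈ {0, …, |w|+1}`. -/
def tapeAt {A : Type} (w : List A) (m : ℕ) : TapeSym A :=
  if m = 0 then TapeSym.lend
  else
    match w[m - 1]? with
    | some a => TapeSym.letter a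
    | none => TapeSym.rend

/-- Head moves. -/
inductive Dir where
  | left
  | right

/-- A deterministic two-way transducer: finitely many states with an initial state and
a set of final states, and a partial transition/output function (common domain). -/
structure TwoWayT (A B : Type) where
  Q : Type
  [finQ : Fintype Q]
  q0 : Q
  final : Set Q
  trans : Q → TapeSym A → Option ((Q × Dir) × List B)

attribute [instance] TwoWayT.finQ

/-- `TwoWayT.Steps T w c v c'`: on input `⊢w⊣` the transducer can go from
configuration `c` to configuration `c'` producing output `v`. -/
inductive TwoWayT.Steps {A B : Type} (T : TwoWayT A B) (w : List A) :
    T.Q × ℕ → List B → T.Q × ℕ → Prop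
  | refl (c : T.Q × ℕ) : TwoWayT.Steps T w c [] c
  | stepL {q : T.Q} {m : ℕ} {q' : T.Q} {v u : List B} {cf : T.Q × ℕ} :
      T.trans q (tapeAt w m) = some ((q', Dir.left), v) → 1 ≤ m →
      TwoWayT.Steps T w (q', m - 1) u cf → TwoWayT.Steps T w (q, m) (v ++ u) cf
  | stepR {q : T.Q} {m : ℕ} {q' : T.Q} {v u : List B} {cf : T.Q × ℕ} :
      T.trans q (tapeAt w m) = some ((q', Dir.right), v) → m ≤ w.length →
      TwoWayT.Steps T w (q', m + 1) u cf → TwoWayT.Steps T w (q, m) (v ++ u) cf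

/-- The two-way transducer computes the partial function `f`: `f w = some v` iff there
is an accepting run on `⊢w⊣` (from `(q0, 0)` to `(q, |w|+1)` with `q` final)
producing `v`. -/
def TwoWayT.Computes {A B : Type} (T : TwoWayT A B) (f : List A → Option (List B)) : Prop :=
  ∀ w v, f w = some v ↔ ∃ q ∈ T.final, TwoWayT.Steps T w (T.q0, 0) v (q, w.length + 1)

/-! ### Marble transducers -/

/-- Actions of a marble transducer: move left, move right, lift the marble, or drop a
marble of color `c`. -/
inductive MAct (C : Type) where
  | left
  | right
  | lift
  | drop (c : C)

/-- A deterministic marble transducer: finitely many states with an initial state and a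
set of final states, finitely many marble colors `C`, and a partial transition/output
function (common domain) reading the current state, the tape symbol, and the color of
the marble at the current position (if any); on a position carrying a marble the head
may only move left or lift the marble. -/
structure MarbleT (A B : Type) where
  Q : Type
  C : Type
  [finQ : Fintype Q]
  [finC : Fintype C]
  q0 : Q
  final : Set Q
  trans : Q → TapeSym A → Option C → Option ((Q × MAct C) × List B)
  marble_left_or_lift : ∀ q s c p, trans q s (some c) = some p →
    p.1.2 = MAct.left ∨ p.1.2 = MAct.lift

attribute [instance] MarbleT.finQ MarbleT.finC

/-- The color of the marble at position `m`, for a stack `π` of dropped marbles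
(topmost first, positions strictly increasing from the top and all ≥ the head
position). -/
def marbleAt {C : Type} (m : ℕ) : List (C × ℕ) → Option C
  | [] => none
  | (c, p) :: _ => if p = m then some c else none

/-- `MarbleT.Steps T w c v c'`: on input `⊢w⊣` the marble transducer can go from
configuration `c` to configuration `c'` producing output `v`. A configuration is a
triple (state, head position, stack of dropped marbles). -/
inductive MarbleT.Steps {A B : Type} (T : MarbleT A B) (w : List A) :
    T.Q × ℕ × List (T.C × ℕ) → List B → T.Q × ℕ × List (T.C × ℕ) → Prop
  | refl (c : T.Q × ℕ × List (T.C × ℕ)) : MarbleT.Steps T w c [] c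
  | stepL {q : T.Q} {m : ℕ} {π : List (T.C × ℕ)} {q' : T.Q} {v u : List B}
      {cf : T.Q × ℕ × List (T.C × ℕ)} :
      T.trans q (tapeAt w m) (marbleAt m π) = some ((q', MAct.left), v) → 1 ≤ m →
      MarbleT.Steps T w (q', m - 1, π) u cf → MarbleT.Steps T w (q, m, π) (v ++ u) cf
  | stepR {q : T.Q} {m : ℕ} {π : List (T.C × ℕ)} {q' : T.Q} {v u : List B}
      {cf : T.Q × ℕ × List (T.C × ℕ)} :
      marbleAt m π = none →
      T.trans q (tapeAt w m) none = some ((q', MAct.right), v) → m ≤ w.length →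
      MarbleT.Steps T w (q', m + 1, π) u cf → MarbleT.Steps T w (q, m, π) (v ++ u) cf
  | stepLift {q : T.Q} {m : ℕ} {π : List (T.C × ℕ)} {q' : T.Q} {cc : T.C} {v u : List B}
      {cf : T.Q × ℕ × List (T.C × ℕ)} :
      T.trans q (tapeAt w m) (some cc) = some ((q', MAct.lift), v) →
      MarbleT.Steps T w (q', m, π) u cf →
      MarbleT.Steps T w (q, m, (cc, m) :: π) (v ++ u) cf
  | stepDrop {q : T.Q} {m : ℕ} {π : List (T.C × ℕ)} {q' : T.Q} {cc : T.C} {v u : List B}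
      {cf : T.Q × ℕ × List (T.C × ℕ)} :
      marbleAt m π = none →
      T.trans q (tapeAt w m) none = some ((q', MAct.drop cc), v) →
      MarbleT.Steps T w (q', m, (cc, m) :: π) u cf →
      MarbleT.Steps T w (q, m, π) (v ++ u) cf

/-- The marble transducer computes the partial function `f`: `f w = some v` iff there is
an accepting run on `⊢w⊣` (from `(q0, 0, ε)` to `(q, |w|+1, ε)` with `q` final)
producing `v`. -/
def MarbleT.Computes {A B : Type} (T : MarbleT A B) (f : List A → Option (List B)) : Prop :=
  ∀ w v, f w = some v ↔
    ∃ q ∈ T.final, MarbleT.Steps T w (T.q0, 0, []) v (q, w.length + 1, [])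

/-- A `k`-marble transducer: every configuration reachable from the initial
configuration carries at most `k` marbles. -/
def MarbleT.IsKMarble {A B : Type} (T : MarbleT A B) (k : ℕ) : Prop :=
  ∀ (w : List A) (u : List B) (cfg : T.Q × ℕ × List (T.C × ℕ)),
    MarbleT.Steps T w (T.q0, 0, []) u cfg → cfg.2.2.length ≤ k

/-- `f` is computable by a `k`-marble transducer. -/
def ComputableKMarble {A B : Type} (f : List A → List B) (k : ℕ) : Prop :=
  ∃ T : MarbleT A B, T.IsKMarble k ∧ T.Computes (fun w => some (f w))

/-! ### Matrices over ℕ and ℕ-automata -/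

/-- Product of two square matrices over `ℕ` (given as functions). -/
def matMul {Q : Type} [Fintype Q] (M N : Q → Q → ℕ) : Q → Q → ℕ :=
  fun i j => ∑ x : Q, M i x * N x j

/-- Identity matrix over `ℕ`. -/
def matId {Q : Type} [DecidableEq Q] : Q → Q → ℕ :=
  fun i j => if i = j then 1 else 0

/-- Row vector times matrix. -/
def vecMat {Q : Type} [Fintype Q] (v : Q → ℕ) (M : Q → Q → ℕ) : Q → ℕ :=
  fun j => ∑ x : Q, v x * M x j

/-- Matrix times column vector. -/
def matVec {Q : Type} [Fintype Q] (M : Q → Q → ℕ) (v : Q → ℕ) : Q → ℕ :=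
  fun i => ∑ x : Q, M i x * v x

/-- Dot product of two vectors over `ℕ`. -/
def dotProd {Q : Type} [Fintype Q] (v w : Q → ℕ) : ℕ :=
  ∑ x : Q, v x * w x

/-- An `ℕ`-automaton: a finite set of states `Q`, an initial row vector `α`, a weight
matrix `μ a` for every letter `a` (extended to words as a monoid morphism `μW`), and a
final column vector `β`. -/
structure NAut (A : Type) where
  Q : Type
  [finQ : Fintype Q]
  [decQ : DecidableEq Q]
  α : Q → ℕ
  μ : A → Q → Q → ℕ
  β : Q → ℕ

attribute [instance] NAut.finQ NAut.decQ

/-- The monoid morphism `A* → ℕ^{Q×Q}` extending `μ`. -/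
def NAut.μW {A : Type} (T : NAut A) : List A → T.Q → T.Q → ℕ
  | [] => matId
  | a :: w => matMul (T.μ a) (T.μW w)

/-- The total function `g : A* → ℕ` computed by the `ℕ`-automaton: `g w = α·μ(w)·β`. -/
def NAut.g {A : Type} (T : NAut A) (w : List A) : ℕ :=
  dotProd (vecMat T.α (T.μW w)) T.β

/-- Trimness: every state is accessible and co-accessible with nonzero weight. -/
def NAut.Trim {A : Type} (T : NAut A) : Prop :=
  ∀ q : T.Q, (∃ u, 1 ≤ vecMat T.α (T.μW u) q) ∧ (∃ v, 1 ≤ matVec (T.μW v) T.β q)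

/-- A heavy cycle on state `q`: a nonempty word `v` with `μ(v)(q,q) ≥ 2`. -/
def NAut.HeavyCycle {A : Type} (T : NAut A) (q : T.Q) (v : List A) : Prop :=
  v ≠ [] ∧ 2 ≤ T.μW v q q

/-- A barbell from `q` to `q' ≠ q`: a nonempty word `v` with `μ(v)(q,q) ≥ 1`,
`μ(v)(q,q') ≥ 1` and `μ(v)(q',q') ≥ 1`. -/
def NAut.Barbell {A : Type} (T : NAut A) (q q' : T.Q) (v : List A) : Prop :=
  q ≠ q' ∧ v ≠ [] ∧ 1 ≤ T.μW v q q ∧ 1 ≤ T.μW v q q' ∧ 1 ≤ T.μW v q' q'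

/-- Edge of the barbell graph `𝔊`. -/
def NAut.GEdge {A : Type} (T : NAut A) (q1 q2 : T.Q) : Prop :=
  ∃ q q' v, T.Barbell q q' v ∧ (∃ w, 1 ≤ T.μW w q1 q) ∧ (∃ w', 1 ≤ T.μW w' q' q2)

/-- `PathLen G q n`: there is a directed path of length `n` (counting edges) in the
graph `G` ending in `q`. -/
inductive PathLen {Q : Type} (G : Q → Q → Prop) : Q → ℕ → Prop
  | zero (q : Q) : PathLen G q 0
  | succ {p q : Q} {n : ℕ} : PathLen G p n → G p q → PathLen G q (n + 1)

/-- The height of `q` in the graph `G` is `n`: the maximal length of a directed path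
ending in `q` is `n`. -/
def HeightIs {Q : Type} (G : Q → Q → Prop) (q : Q) (n : ℕ) : Prop :=
  PathLen G q n ∧ ∀ m, PathLen G q m → m ≤ n

/-! ### Statement-specific predicates -/

/-- Case (1) of the trichotomy: `|f|` has exponential growth and `f` is not computable
with `k` marbles for any `k`. -/
def MarbleCase1 {A B : Type} (f : List A → List B) : Prop :=
  ExpGrowth (fun w => (f w).length) ∧ ∀ k : ℕ, ¬ ComputableKMarble f k

/-- Case (2) of the trichotomy: `|f|` has `(k+1)`-polynomial growth for some `k`, `f` is
computable with `k` marbles, and `k` is the least possible number of marbles. -/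
def MarbleCase2 {A B : Type} (f : List A → List B) : Prop :=
  ∃ k : ℕ, PolyGrowth (fun w => (f w).length) (k + 1) ∧ ComputableKMarble f k ∧
    ∀ j : ℕ, ComputableKMarble f j → k ≤ j

/-- Case (3) of the trichotomy: `|f|` has `0`-polynomial growth and `f` is computable
with `0` marbles. -/
def MarbleCase3 {A B : Type} (f : List A → List B) : Prop :=
  PolyGrowth (fun w => (f w).length) 0 ∧ ComputableKMarble f 0

/-- The second alternative of Lemma `lem:graph`: `g` has `k`-polynomial growth for some
`k ≥ 0` and the states admit a partition `S_0, …, S_k` satisfying (a), (b), (c). -/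
def NAutPolyCase {A : Type} (T : NAut A) : Prop :=
  ∃ k : ℕ, PolyGrowth T.g k ∧
    ∃ S : T.Q → Fin (k + 1),
      (∀ q q' : T.Q, (∃ w, 1 ≤ T.μW w q q') → S q ≤ S q') ∧
      (∃ Bd : ℕ, ∀ q q' : T.Q, S q = S q' → ∀ w, T.μW w q q' ≤ Bd) ∧
      (∀ q : T.Q, ∃ C : ℕ, ∀ w, vecMat T.α (T.μW w) q ≤ C * w.length ^ (S q : ℕ) + C)

/-! ### Boundedness of matrix monoids without heavy cycles and barbells -/

namespace Bdd

set_option linter.unusedSectionVars false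

variable {A Q : Type} [Fintype Q] [DecidableEq Q]

theorem mul_entry_le (M N : Matrix Q Q ℕ) (p s r : Q) : M p s * N s r ≤ (M * N) p r := by
  rw [Matrix.mul_apply]
  exact Finset.single_le_sum (f := fun s => M p s * N s r) (fun _ _ => Nat.zero_le _)
    (Finset.mem_univ s)

theorem mul_entry_pos (M N : Matrix Q Q ℕ) {p s r : Q} (h1 : 1 ≤ M p s) (h2 : 1 ≤ N s r) :
    1 ≤ (M * N) p r :=
  le_trans (Nat.mul_le_mul h1 h2) (mul_entry_le M N p s r)

theorem exists_mid (M N : Matrix Q Q ℕ) {p r : Q} (h : 1 ≤ (M * N) p r) :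
    ∃ s, 1 ≤ M p s ∧ 1 ≤ N s r := by
  by_contra hc
  push Not at hc
  have : (M * N) p r = 0 := by
    rw [Matrix.mul_apply]
    refine Finset.sum_eq_zero fun s _ => ?_
    by_cases h1 : 1 ≤ M p s
    · have := hc s h1
      have h0 : N s r = 0 := by omega
      simp [h0]
    · have h0 : M p s = 0 := by omega
      simp [h0]
  omega

theorem pow_chain_pred (N : Matrix Q Q ℕ) (F : Q → Prop) (σ : Q → Q)
    (hσ : ∀ p, F p → F (σ p) ∧ 1 ≤ N (σ p) p) (n : ℕ) (p : Q) (hp : F p) :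
    F (σ^[n] p) ∧ 1 ≤ (N ^ n) (σ^[n] p) p := by
  induction n with
  | zero => simp [hp]
  | succ n ih =>
    obtain ⟨h1, h2⟩ := ih
    rw [Function.iterate_succ_apply', pow_succ']
    exact ⟨(hσ _ h1).1, mul_entry_pos _ _ (hσ _ h1).2 h2⟩

theorem pow_chain_succ (N : Matrix Q Q ℕ) (F : Q → Prop) (σ : Q → Q)
    (hσ : ∀ p, F p → F (σ p) ∧ 1 ≤ N p (σ p)) (n : ℕ) (p : Q) (hp : F p) :
    F (σ^[n] p) ∧ 1 ≤ (N ^ n) p (σ^[n] p) := by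
  induction n with
  | zero => simp [hp]
  | succ n ih =>
    obtain ⟨h1, h2⟩ := ih
    rw [Function.iterate_succ_apply', pow_succ]
    exact ⟨(hσ _ h1).1, mul_entry_pos _ _ h2 (hσ _ h1).2⟩

/-- A common idempotent exponent for two self-maps of a finite type. -/
theorem exists_idem (σ τ : Q → Q) :
    ∃ n, 1 ≤ n ∧ (∀ x, σ^[n] (σ^[n] x) = σ^[n] x) ∧ (∀ x, τ^[n] (τ^[n] x) = τ^[n] x) := by
  have key : ∀ f : Q → Q, ∃ n, 1 ≤ n ∧ ∀ k, 1 ≤ k → ∀ x, f^[n*k] (f^[n*k] x) = f^[n*k] x := by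
    intro f
    obtain ⟨i, j, hij, h⟩ := Finite.exists_ne_map_eq_of_infinite (fun n : ℕ => f^[n])
    wlog hlt : i < j generalizing i j
    · exact this j i hij.symm h.symm (by omega)
    obtain ⟨d, rfl⟩ := Nat.exists_eq_add_of_lt hlt
    have hper : ∀ m, i ≤ m → ∀ t x, f^[m + (d+1) * t] x = f^[m] x := by
      intro m hm t x
      induction t with
      | zero => simp
      | succ t ih =>
        obtain ⟨e, rfl⟩ := Nat.exists_eq_add_of_le hm
        have h' : ∀ y, f^[i] y = f^[i + d + 1] y := fun y => congrFun h y
        rw [show i + e + (d+1)*(t+1) = (i + d + 1) + (e + (d+1)*t) by ring,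
          Function.iterate_add_apply, ← h', ← Function.iterate_add_apply, ← ih,
          show i + (e + (d+1)*t) = i + e + (d+1)*t by ring]
    refine ⟨(d+1) * (i+1), Nat.mul_pos (by omega) (by omega), fun k hk x => ?_⟩
    rw [← Function.iterate_add_apply]
    have : (d+1) * (i+1) * k + (d+1) * (i+1) * k = (d+1) * (i+1) * k + (d+1) * ((i+1)*k) := by ring
    rw [this, hper]
    calc i ≤ 1 * (i+1) * 1 := by omega
      _ ≤ (d+1) * (i+1) * k := Nat.mul_le_mul (Nat.mul_le_mul (by omega) le_rfl) hk
  obtain ⟨n, hn, h1⟩ := key σ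
  obtain ⟨m, hm, h2⟩ := key τ
  refine ⟨n * m, Nat.mul_pos hn hm, h1 m hm, ?_⟩
  rw [mul_comm]
  exact h2 n hn

/-- From a stable forward set `F` and a stable backward set `G` linked by `N`,
extract a barbell of a power of `N`. -/
theorem barbell_of_sets (N : Matrix Q Q ℕ) (F G : Q → Prop)
    (hF : ∀ p, F p → ∃ p', F p' ∧ 1 ≤ N p' p)
    (hG : ∀ p, G p → ∃ p', G p' ∧ 1 ≤ N p p')
    (p r : Q) (hp : F p) (hr : G r) (hpr : 1 ≤ N p r) :
    ∃ n a b, F a ∧ G b ∧ 1 ≤ (N ^ n) a a ∧ 1 ≤ (N ^ n) a b ∧ 1 ≤ (N ^ n) b b := by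
  classical
  have hF' : ∀ p, ∃ p', F p → F p' ∧ 1 ≤ N p' p := fun p => by
    by_cases h : F p
    · obtain ⟨p', h'⟩ := hF p h; exact ⟨p', fun _ => h'⟩
    · exact ⟨p, fun h' => absurd h' h⟩
  have hG' : ∀ p, ∃ p', G p → G p' ∧ 1 ≤ N p p' := fun p => by
    by_cases h : G p
    · obtain ⟨p', h'⟩ := hG p h; exact ⟨p', fun _ => h'⟩
    · exact ⟨p, fun h' => absurd h' h⟩
  choose σ hσ using hF'
  choose τ hτ using hG'
  obtain ⟨n, hn, iσ, iτ⟩ := exists_idem σ τ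
  obtain ⟨m, rfl⟩ := Nat.exists_eq_add_of_le' hn
  set a := σ^[m+1] (σ^[m] p) with ha
  set b := τ^[m+1] r with hb
  have hFm := pow_chain_pred N F σ hσ m p hp
  have hFa := pow_chain_pred N F σ hσ (m+1) _ hFm.1
  have hGb := pow_chain_succ N G τ hτ (m+1) r hr
  have haa : σ^[m+1] a = a := iσ _
  have hbb : τ^[m+1] b = b := iτ _
  have la := (pow_chain_pred N F σ hσ (m+1) a hFa.1).2
  have lb := (pow_chain_succ N G τ hτ (m+1) b hGb.1).2
  rw [haa] at la
  rw [hbb] at lb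
  have e3 : N ^ ((m+1) + (m+1) + (m+1)) = N^(m+1) * N^(m+1) * N^(m+1) := by
    rw [pow_add, pow_add]
  have e3' : N ^ ((m+1) + (m+1) + (m+1)) = N^(m+1) * N^m * N * N^(m+1) := by
    rw [← pow_add, ← pow_succ, ← pow_add]; congr 1
  refine ⟨(m+1) + (m+1) + (m+1), a, b, hFa.1, hGb.1, ?_, ?_, ?_⟩
  · rw [e3]
    exact mul_entry_pos _ _ (mul_entry_pos _ _ la la) la
  · rw [e3']
    exact mul_entry_pos _ _ (mul_entry_pos _ _ (mul_entry_pos _ _ hFa.2 hFm.2) hpr) hGb.2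
  · rw [e3]
    exact mul_entry_pos _ _ (mul_entry_pos _ _ lb lb) lb

theorem hom_pow (M : List A → Matrix Q Q ℕ) (h1 : M [] = 1)
    (hm : ∀ u v, M (u ++ v) = M u * M v) (v : List A) (n : ℕ) :
    M ((List.replicate n v).flatten) = (M v) ^ n := by
  induction n with
  | zero => simpa using h1
  | succ n ih => rw [List.replicate_succ, List.flatten_cons, hm, ih, pow_succ']

theorem tele (f c : ℕ → ℕ) (n : ℕ) (h : ∀ i < n, f i ≤ f (i+1) + c i) :
    f 0 ≤ f n + ∑ i ∈ Finset.range n, c i := by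
  induction n with
  | zero => simp
  | succ n ih =>
    have := ih fun i hi => h i (by omega)
    have := h n (by omega)
    rw [Finset.sum_range_succ]
    omega

open Classical in
theorem core_step [Finite A] (M : List A → Matrix Q Q ℕ) (h1 : M [] = 1)
    (hm : ∀ u v, M (u ++ v) = M u * M v) (P : Q → Prop)
    (hconv : ∀ p s r u v, P p → P r → 1 ≤ M u p s → 1 ≤ M v s r → P s)
    (hheavy : ∀ p v, P p → M v p p ≤ 1)
    (hbar : ∀ p p' v, P p → P p' → p ≠ p' → 1 ≤ M v p p → 1 ≤ M v p p' → 1 ≤ M v p' p' → False)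
    (q' : Q) (hq' : P q') (q : Q) (hq : P q) (K : ℕ)
    (hK : ∀ r, (∃ u, 1 ≤ M u q r) → (¬ ∃ u, 1 ≤ M u r q) → ∀ v, M v r q' ≤ K) :
    ∃ K', ∀ w, M w q q' ≤ K' := by
  set R : Q → Q → Prop := fun p r => ∃ u, 1 ≤ M u p r with hR
  have Rtrans : ∀ p s r, R p s → R s r → R p r := by
    rintro p s r ⟨u, hu⟩ ⟨v, hv⟩
    exact ⟨u ++ v, by rw [hm]; exact mul_entry_pos _ _ hu hv⟩
  -- letters
  obtain ⟨L, hL⟩ : ∃ L, ∀ e : List A, e.length ≤ 1 → ∀ p r, M e p r ≤ L := by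
    have hfin := List.finite_length_le A 1
    obtain ⟨L, hL⟩ := (hfin.image (fun e => ∑ p, ∑ r, M e p r)).bddAbove
    refine ⟨L, fun e he p r => le_trans ?_ (hL ⟨e, he, rfl⟩)⟩
    refine le_trans ?_ (Finset.single_le_sum (f := fun p => ∑ r, M e p r)
      (fun _ _ => Nat.zero_le _) (Finset.mem_univ p))
    exact Finset.single_le_sum (f := fun r => M e p r)
      (fun _ _ => Nat.zero_le _) (Finset.mem_univ r)
  -- inside the component of `q`, weights are at most one
  have hone : ∀ u p, R p q → M u q p ≤ 1 := by
    rintro u p ⟨v, hv⟩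
    have h2 := hheavy q (u ++ v) hq
    rw [hm] at h2
    have h3 := mul_entry_le (M u) (M v) q p q
    nlinarith
  let S : Finset Q := Finset.univ.filter fun p => R p q
  let S' : Finset Q := Finset.univ.filter fun p => ¬ R p q
  set Cc := Fintype.card Q * (Fintype.card Q * (L * K)) with hCc
  refine ⟨1 + Fintype.card (Finset Q × Finset Q) * Cc, fun w => ?_⟩
  let e : ℕ → List A := fun i => (w.drop i).take 1
  have he : ∀ i, (e i).length ≤ 1 := fun i => by simp [e]
  have hdrop : ∀ i, w.drop i = e i ++ w.drop (i+1) := fun i => by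
    have := List.take_append_drop 1 (w.drop i)
    rw [List.drop_drop] at this
    exact this.symm
  have htake : ∀ i, w.take (i+1) = w.take i ++ e i := fun i => by
    rw [List.take_add]
  let Ai : ℕ → ℕ := fun i => ∑ p ∈ S, M (w.take i) q p * M (w.drop i) p q'
  let Di : ℕ → ℕ := fun i =>
    ∑ p ∈ S, ∑ r ∈ S', M (w.take i) q p * M (e i) p r * M (w.drop (i+1)) r q'
  have hstep : ∀ i, Ai i ≤ Ai (i+1) + Di i := by
    intro i
    have e1 : Ai i = ∑ p ∈ S, ∑ r : Q, M (w.take i) q p * M (e i) p r * M (w.drop (i+1)) r q' := by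
      refine Finset.sum_congr rfl fun p _ => ?_
      rw [hdrop i, hm, Matrix.mul_apply, Finset.mul_sum]
      exact Finset.sum_congr rfl fun r _ => by ring
    have e2 : Ai i = (∑ p ∈ S, ∑ r ∈ S, M (w.take i) q p * M (e i) p r * M (w.drop (i+1)) r q')
        + Di i := by
      rw [e1, ← Finset.sum_add_distrib]
      refine Finset.sum_congr rfl fun p _ => ?_
      exact (Finset.sum_filter_add_sum_filter_not _ _ _).symm
    rw [e2]
    refine Nat.add_le_add_right ?_ _
    rw [Finset.sum_comm]
    refine Finset.sum_le_sum fun r _ => ?_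
    rw [← Finset.sum_mul, htake i, hm, Matrix.mul_apply]
    refine Nat.mul_le_mul_right _ ?_
    exact Finset.sum_le_sum_of_subset (Finset.subset_univ _)
  have hA0 : Ai 0 = M w q q' := by
    have : Ai 0 = ∑ p ∈ S, (if q = p then 1 else 0) * M w p q' := by
      refine Finset.sum_congr rfl fun p _ => ?_
      simp [h1, Matrix.one_apply]
    rw [this]
    have hqS : q ∈ S := by
      simp only [S, Finset.mem_filter, Finset.mem_univ, true_and]
      exact ⟨[], by rw [h1]; simp⟩
    simp [hqS]
  have hAn : Ai w.length ≤ 1 := by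
    have : Ai w.length = ∑ p ∈ S, M w q p * (if p = q' then 1 else 0) := by
      refine Finset.sum_congr rfl fun p _ => ?_
      simp [h1, Matrix.one_apply]
    rw [this]
    simp only [mul_ite, mul_one, mul_zero, Finset.sum_ite_eq']
    split_ifs with hh
    · exact hone _ _ (by simpa [S] using hh)
    · omega
  have hD : ∀ i, Di i ≤ Cc := by
    intro i
    have hterm : ∀ p ∈ S, ∀ r ∈ S',
        M (w.take i) q p * M (e i) p r * M (w.drop (i+1)) r q' ≤ L * K := by
      intro p hp r hr
      have hp' : R p q := by simpa [S] using hp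
      have hr' : ¬ R r q := by simpa [S'] using hr
      by_cases z1 : 1 ≤ M (w.take i) q p
      · by_cases z2 : 1 ≤ M (e i) p r
        · have hqr : R q r := Rtrans q p r ⟨_, z1⟩ ⟨_, z2⟩
          have a1 := hone (w.take i) p hp'
          have a2 := hL (e i) (he i) p r
          have a3 := hK r hqr hr' (w.drop (i+1))
          calc _ ≤ 1 * L * K := Nat.mul_le_mul (Nat.mul_le_mul a1 a2) a3
            _ = _ := by ring
        · have : M (e i) p r = 0 := by omega
          simp [this]
      · have : M (w.take i) q p = 0 := by omega
        simp [this]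
    have hrow : ∀ p ∈ S, (∑ r ∈ S', M (w.take i) q p * M (e i) p r * M (w.drop (i+1)) r q')
        ≤ Fintype.card Q * (L * K) := by
      intro p hp
      refine le_trans (Finset.sum_le_card_nsmul _ _ _ (hterm p hp)) ?_
      rw [smul_eq_mul]
      exact Nat.mul_le_mul_right _ (Finset.card_le_univ _)
    refine le_trans (Finset.sum_le_card_nsmul _ _ _ hrow) ?_
    rw [smul_eq_mul]
    exact Nat.mul_le_mul_right _ (Finset.card_le_univ _)
  -- crossing positions
  let Cr : Finset ℕ := (Finset.range w.length).filter fun i => Di i ≠ 0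
  let Fs : ℕ → Finset Q := fun i => Finset.univ.filter fun p => R p q ∧ 1 ≤ M (w.take i) q p
  let Gs : ℕ → Finset Q := fun i => Finset.univ.filter fun p => ¬ R p q ∧ 1 ≤ M (w.drop i) p q'
  have hinj : ∀ i j, i < j → Di i ≠ 0 → Fs i = Fs j → Gs i = Gs j → False := by
    intro i j hij hDi hF hG
    obtain ⟨p, hp, hp'⟩ := Finset.exists_ne_zero_of_sum_ne_zero hDi
    obtain ⟨r, hr, hr'⟩ := Finset.exists_ne_zero_of_sum_ne_zero hp'
    have hpq : R p q := by simpa [S] using hp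
    have hrq : ¬ R r q := by simpa [S'] using hr
    have z1 : 1 ≤ M (w.take i) q p := by
      by_contra hc
      have : M (w.take i) q p = 0 := by omega
      simp [this] at hr'
    have z2 : 1 ≤ M (e i) p r := by
      by_contra hc
      have : M (e i) p r = 0 := by omega
      simp [this] at hr'
    have z3 : 1 ≤ M (w.drop (i+1)) r q' := by
      by_contra hc
      have : M (w.drop (i+1)) r q' = 0 := by omega
      simp [this] at hr'
    obtain ⟨m, rfl⟩ := Nat.exists_eq_add_of_lt hij
    let v' := (w.drop (i+1)).take m
    have d1 : w.drop (i+1) = v' ++ w.drop (i+m+1) := by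
      have := List.take_append_drop m (w.drop (i+1))
      rw [List.drop_drop, show i+1+m = i+m+1 by ring] at this
      exact this.symm
    let v := e i ++ v'
    have d2 : w.drop i = v ++ w.drop (i+m+1) := by
      rw [hdrop i, d1, List.append_assoc]
    have d3 : w.take (i+m+1) = w.take i ++ v := by
      rw [show i+m+1 = (i+1)+m by ring, List.take_add, htake i, List.append_assoc]
    -- the link
    have z3' := z3
    rw [d1, hm] at z3'
    obtain ⟨t, ht1, ht2⟩ := exists_mid _ _ z3'
    have htq : ¬ R t q := fun h => hrq (Rtrans r t q ⟨_, ht1⟩ h)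
    have hpt : 1 ≤ M v p t := by
      rw [hm]; exact mul_entry_pos _ _ z2 ht1
    have memF : ∀ i x, x ∈ Fs i ↔ R x q ∧ 1 ≤ M (w.take i) q x := fun i x => by simp [Fs]
    have memG : ∀ i x, x ∈ Gs i ↔ ¬ R x q ∧ 1 ≤ M (w.drop i) x q' := fun i x => by
      simp only [Gs, Finset.mem_filter, Finset.mem_univ, true_and]
    obtain ⟨n, a, b, Fa, Gb, laa, lab, lbb⟩ := barbell_of_sets (M v)
      (fun x => x ∈ Fs i) (fun x => x ∈ Gs i)
      (by
        intro x hx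
        rw [hF, memF, d3, hm] at hx
        obtain ⟨y, hy1, hy2⟩ := exists_mid _ _ hx.2
        exact ⟨y, (memF _ _).2 ⟨Rtrans y x q ⟨_, hy2⟩ hx.1, hy1⟩, hy2⟩)
      (by
        intro x hx
        rw [memG, d2, hm] at hx
        obtain ⟨y, hy1, hy2⟩ := exists_mid _ _ hx.2
        refine ⟨y, ?_, hy1⟩
        rw [hG]
        exact (memG _ _).2 ⟨fun h => hx.1 (Rtrans x y q ⟨_, hy1⟩ h), hy2⟩)
      p t ((memF _ _).2 ⟨hpq, z1⟩) (by rw [hG]; exact (memG _ _).2 ⟨htq, ht2⟩) hpt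
    rw [memF] at Fa
    rw [memG] at Gb
    rw [← hom_pow M h1 hm] at laa lab lbb
    obtain ⟨x, hx⟩ := Fa.1
    have Pa : P a := hconv q a q _ _ hq hq Fa.2 hx
    have Pb : P b := hconv a b q' _ _ Pa hq' lab Gb.2
    exact hbar a b _ Pa Pb (fun h => Gb.1 (h ▸ Fa.1)) laa lab lbb
  have hcard : Cr.card ≤ Fintype.card (Finset Q × Finset Q) := by
    refine Finset.card_le_card_of_injOn (fun i => (Fs i, Gs i)) (fun _ _ => Finset.mem_univ _) ?_
    intro i hi j hj hij
    have hi' : Di i ≠ 0 := (Finset.mem_filter.1 hi).2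
    have hj' : Di j ≠ 0 := (Finset.mem_filter.1 hj).2
    have hF : Fs i = Fs j := congrArg Prod.fst hij
    have hG : Gs i = Gs j := congrArg Prod.snd hij
    rcases lt_trichotomy i j with h | h | h
    · exact (hinj i j h hi' hF hG).elim
    · exact h
    · exact (hinj j i h hj' hF.symm hG.symm).elim
  have hsum : ∑ i ∈ Finset.range w.length, Di i ≤ Cr.card * Cc := by
    rw [← Finset.sum_filter_ne_zero]
    have := Finset.sum_le_card_nsmul Cr Di Cc (fun i _ => hD i)
    simpa using this
  have := tele Ai Di w.length (fun i _ => hstep i)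
  rw [hA0] at this
  have h3 := Nat.mul_le_mul_right Cc hcard
  omega

open Classical in
theorem core [Finite A] (M : List A → Matrix Q Q ℕ) (h1 : M [] = 1)
    (hm : ∀ u v, M (u ++ v) = M u * M v) (P : Q → Prop)
    (hconv : ∀ p s r u v, P p → P r → 1 ≤ M u p s → 1 ≤ M v s r → P s)
    (hheavy : ∀ p v, P p → M v p p ≤ 1)
    (hbar : ∀ p p' v, P p → P p' → p ≠ p' → 1 ≤ M v p p → 1 ≤ M v p p' → 1 ≤ M v p' p' → False)
    (q' : Q) (hq' : P q') : ∀ q, P q → ∃ K, ∀ w, M w q q' ≤ K := by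
  let c : Q → ℕ := fun q => (Finset.univ.filter fun r => ∃ u, 1 ≤ M u q r).card
  suffices H : ∀ n q, c q = n → P q → ∃ K, ∀ w, M w q q' ≤ K from fun q hq => H _ q rfl hq
  intro n
  induction n using Nat.strong_induction_on with
  | _ n ih =>
  intro q hcq hq
  have hr : ∀ r, ∃ K, (∃ u, 1 ≤ M u q r) → (¬ ∃ u, 1 ≤ M u r q) → ∀ v, M v r q' ≤ K := by
    intro r
    by_cases ha : (∃ u, 1 ≤ M u q r) ∧ (¬ ∃ u, 1 ≤ M u r q)
    · by_cases hP : P r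
      · have hlt : c r < n := by
          rw [← hcq]
          refine Finset.card_lt_card ⟨fun x hx => ?_, fun hsub => ?_⟩
          · simp only [Finset.mem_filter, Finset.mem_univ, true_and] at hx ⊢
            obtain ⟨u, hu⟩ := ha.1
            obtain ⟨v, hv⟩ := hx
            exact ⟨u ++ v, by rw [hm]; exact mul_entry_pos _ _ hu hv⟩
          · have hqm : q ∈ Finset.univ.filter fun x => ∃ u, 1 ≤ M u q x := by
              simp only [Finset.mem_filter, Finset.mem_univ, true_and]
              exact ⟨[], by rw [h1]; simp⟩
            have := hsub hqm
            simp only [Finset.mem_filter, Finset.mem_univ, true_and] at this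
            exact ha.2 this
        obtain ⟨K, hK⟩ := ih _ hlt r rfl hP
        exact ⟨K, fun _ _ => hK⟩
      · refine ⟨0, fun _ _ v => ?_⟩
        by_contra hc
        obtain ⟨u, hu⟩ := ha.1
        exact hP (hconv q r q' u v hq hq' hu (by omega))
    · exact ⟨0, fun x y => absurd ⟨x, y⟩ ha⟩
  choose Kf hKf using hr
  refine core_step M h1 hm P hconv hheavy hbar q' hq' q hq (∑ r, Kf r) fun r x y v => ?_
  exact le_trans (hKf r x y v)
    (Finset.single_le_sum (f := Kf) (fun _ _ => Nat.zero_le _) (Finset.mem_univ r))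

end Bdd

/-! ### Length matrices of a simple SST -/

namespace SimpleSST

variable {A B : Type} (S : SimpleSST A B)

/-- The occurrence matrix of a letter. -/
def mat (a : A) : Matrix S.X S.X ℕ := fun y x => (S.upd a x).count y

/-- The occurrence matrix of a word. -/
def matW (w : List A) : Matrix S.X S.X ℕ := (w.map S.mat).prod

theorem matW_nil : S.matW [] = 1 := rfl

theorem matW_cons (a : A) (w : List A) : S.matW (a :: w) = S.mat a * S.matW w := by
  simp [matW]

theorem matW_singleton (a : A) : S.matW [a] = S.mat a := by simp [matW]

theorem matW_append (u v : List A) : S.matW (u ++ v) = S.matW u * S.matW v := by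
  simp [matW]

theorem length_flatMap_eq {X : Type} [Fintype X] [DecidableEq X] (v : X → List B) (l : List X) :
    (l.flatMap v).length = ∑ y, (v y).length * l.count y := by
  induction l with
  | nil => simp
  | cons z l ih =>
    simp only [List.flatMap_cons, List.length_append, ih, List.count_cons, mul_add,
      Finset.sum_add_distrib]
    rw [add_comm]
    congr 1
    simp

theorem valFrom_append (v : S.X → List B) (u w : List A) :
    S.valFrom v (u ++ w) = S.valFrom (S.valFrom v u) w := by
  induction u generalizing v with
  | nil => rfl
  | cons a u ih => simp only [List.cons_append, valFrom]; exact ih _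

theorem val_append (u w : List A) : S.val (u ++ w) = S.valFrom (S.val u) w :=
  S.valFrom_append _ _ _

theorem val_snoc (u : List A) (a : A) (x : S.X) :
    S.val (u ++ [a]) x = (S.upd a x).flatMap (S.val u) := by
  rw [val_append]; rfl

theorem length_valFrom (v : S.X → List B) (w : List A) (x : S.X) :
    (S.valFrom v w x).length = ∑ y, (v y).length * S.matW w y x := by
  induction w generalizing v with
  | nil => simp [valFrom, matW_nil, Matrix.one_apply]
  | cons a w ih =>
    rw [valFrom, ih, matW_cons]
    simp only [length_flatMap_eq, Matrix.mul_apply, Finset.mul_sum, Finset.sum_mul]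
    rw [Finset.sum_comm]
    refine Finset.sum_congr rfl fun y _ => Finset.sum_congr rfl fun z _ => ?_
    simp only [mat]
    ring

theorem length_val_ge (u w : List A) (y x : S.X) :
    (S.val u y).length * S.matW w y x ≤ (S.val (u ++ w) x).length := by
  rw [val_append, length_valFrom]
  exact Finset.single_le_sum (f := fun y => (S.val u y).length * S.matW w y x)
    (fun _ _ => Nat.zero_le _) (Finset.mem_univ y)

/-- The contents of `x` have length `O(|w|^d)`. -/
def Od (d : ℕ) (x : S.X) : Prop := ∃ C : ℕ, ∀ w, (S.val w x).length ≤ C * (w.length + 1) ^ d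

/-- `x` may contribute to the output. -/
def Co (x : S.X) : Prop := ∃ u, ∃ z ∈ S.out, 1 ≤ S.matW u x z

theorem Od.mono {d e : ℕ} {x : S.X} (h : S.Od d x) (hde : d ≤ e) : S.Od e x := by
  obtain ⟨C, hC⟩ := h
  exact ⟨C, fun w => (hC w).trans (Nat.mul_le_mul_left _ (Nat.pow_le_pow_right (by omega) hde))⟩

theorem shift_le (n c d : ℕ) : (n + c + 1) ^ d ≤ (c + 1) ^ d * (n + 1) ^ d := by
  rw [← mul_pow]
  exact Nat.pow_le_pow_left (by nlinarith [Nat.zero_le (n * c)]) d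

theorem Od.pred {d : ℕ} {x y : S.X} {u : List A} (hu : 1 ≤ S.matW u y x) (h : S.Od d x) :
    S.Od d y := by
  obtain ⟨C, hC⟩ := h
  refine ⟨C * (u.length + 1) ^ d, fun w => ?_⟩
  calc (S.val w y).length ≤ (S.val w y).length * S.matW u y x := Nat.le_mul_of_pos_right _ hu
    _ ≤ _ := S.length_val_ge w u y x
    _ ≤ _ := hC _
    _ = C * (w.length + u.length + 1) ^ d := by rw [List.length_append]
    _ ≤ C * ((u.length + 1) ^ d * (w.length + 1) ^ d) := Nat.mul_le_mul_left _ (shift_le _ _ _)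
    _ = _ := by ring

theorem Co.pred {x y : S.X} {u : List A} (hu : 1 ≤ S.matW u y x) (h : S.Co x) : S.Co y := by
  obtain ⟨v, z, hz, hv⟩ := h
  exact ⟨u ++ v, z, hz, by rw [matW_append]; exact Bdd.mul_entry_pos _ _ hu hv⟩

theorem Co.Od {k : ℕ} (h : ∃ C : ℕ, ∀ w, (S.eval w).length ≤ C * w.length ^ k + C) {x : S.X}
    (hx : S.Co x) : S.Od k x := by
  obtain ⟨u, z, hz, hu⟩ := hx
  refine Od.pred S hu ?_
  obtain ⟨C, hC⟩ := h
  refine ⟨2 * C, fun w => ?_⟩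
  have h1 : (S.val w z).length ≤ (S.eval w).length := by
    rw [eval, length_flatMap_eq]
    refine le_trans ?_ (Finset.single_le_sum (f := fun y => (S.val w y).length * S.out.count y)
      (fun _ _ => Nat.zero_le _) (Finset.mem_univ z))
    exact Nat.le_mul_of_pos_right _ (List.count_pos_iff.2 hz)
  have h2 : w.length ^ k ≤ (w.length + 1) ^ k := Nat.pow_le_pow_left (by omega) k
  have h3 : 1 ≤ (w.length + 1) ^ k := Nat.one_le_pow _ _ (by omega)
  have := hC w
  nlinarith

open Classical in
/-- The growth degree of `x`. -/
noncomputable def deg (x : S.X) : ℕ := sInf {d | S.Od d x}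

theorem Od_deg {x : S.X} {d : ℕ} (h : S.Od d x) : S.Od (S.deg x) x :=
  Nat.sInf_mem (s := {d | S.Od d x}) ⟨d, h⟩

theorem deg_le {x : S.X} {d : ℕ} (h : S.Od d x) : S.deg x ≤ d := Nat.sInf_le h

theorem deg_mono {x y : S.X} {u : List A} {d : ℕ} (hu : 1 ≤ S.matW u y x) (h : S.Od d x) :
    S.deg y ≤ S.deg x :=
  S.deg_le (Od.pred S hu (S.Od_deg h))

/-- Pumping a word with at least linear weight between two registers raises the degree. -/
theorem no_pump {p p' : S.X} {d : ℕ} (hp' : S.Od (d+1) p') (v : List A)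
    (h : ∀ m, m ≤ (S.matW v ^ m) p p') : S.Od d p := by
  obtain ⟨C, hC⟩ := hp'
  refine ⟨C * (v.length + 1) ^ (d+1), fun w => ?_⟩
  have h1 := S.length_val_ge w ((List.replicate (w.length+1) v).flatten) p p'
  rw [Bdd.hom_pow S.matW S.matW_nil S.matW_append] at h1
  have h2 := hC (w ++ (List.replicate (w.length+1) v).flatten)
  have h3 := Nat.mul_le_mul_left (S.val w p).length (h (w.length+1))
  have hlen : (w ++ (List.replicate (w.length+1) v).flatten).length + 1
      = (v.length + 1) * (w.length + 1) := by
    simp [List.length_flatten]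
    ring
  rw [hlen, mul_pow] at h2
  have h4 : (S.val w p).length * (w.length + 1)
      ≤ C * (v.length + 1) ^ (d+1) * (w.length + 1) ^ d * (w.length + 1) := by
    calc _ ≤ _ := h3
      _ ≤ _ := h1
      _ ≤ _ := h2
      _ = _ := by ring
  exact Nat.le_of_mul_le_mul_right h4 (by omega)

theorem heavy_pow (N : Matrix S.X S.X ℕ) (p : S.X) (h : 2 ≤ N p p) (m : ℕ) :
    m + 1 ≤ (N ^ m) p p := by
  induction m with
  | zero => simp
  | succ m ih =>
    rw [pow_succ]
    have := Bdd.mul_entry_le (N ^ m) N p p p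
    nlinarith

theorem diag_pow (N : Matrix S.X S.X ℕ) (p : S.X) (h : 1 ≤ N p p) (m : ℕ) :
    1 ≤ (N ^ m) p p := by
  induction m with
  | zero => simp
  | succ m ih => rw [pow_succ]; exact Bdd.mul_entry_pos _ _ ih h

theorem barbell_pow (N : Matrix S.X S.X ℕ) (p p' : S.X) (hne : p ≠ p') (h1 : 1 ≤ N p p)
    (h2 : 1 ≤ N p p') (h3 : 1 ≤ N p' p') (m : ℕ) : m ≤ (N ^ m) p p' := by
  induction m with
  | zero => simp
  | succ m ih =>
    rw [pow_succ, Matrix.mul_apply]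
    have hs : ∑ s ∈ ({p, p'} : Finset S.X), (N ^ m) p s * N s p'
        ≤ ∑ s, (N ^ m) p s * N s p' :=
      Finset.sum_le_sum_of_subset (Finset.subset_univ _)
    rw [Finset.sum_pair hne] at hs
    have a1 : 1 * 1 ≤ (N ^ m) p p * N p p' := Nat.mul_le_mul (diag_pow S N p h1 m) h2
    have a2 : m * 1 ≤ (N ^ m) p p' * N p' p' := Nat.mul_le_mul ih h3
    omega

/-- Uniform bound for weights between registers of the same positive degree. -/
theorem exists_bound [Finite A] {k : ℕ} (hk : ∀ x, S.Co x → S.Od k x) :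
    ∃ K, ∀ y x, S.Co y → S.Co x → S.deg y = S.deg x → 1 ≤ S.deg x → ∀ w, S.matW w y x ≤ K := by
  have key : ∀ yx : S.X × S.X, ∃ K, S.Co yx.1 → S.Co yx.2 → S.deg yx.1 = S.deg yx.2 →
      1 ≤ S.deg yx.2 → ∀ w, S.matW w yx.1 yx.2 ≤ K := by
    rintro ⟨y, x⟩
    by_cases hh : S.Co y ∧ S.Co x ∧ S.deg y = S.deg x ∧ 1 ≤ S.deg x
    · obtain ⟨cy, cx, hd, hpos⟩ := hh
      obtain ⟨d, hd'⟩ := Nat.exists_eq_add_of_le' hpos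
      have pump : ∀ p p' v, (S.Co p ∧ S.deg p = S.deg x) → (S.Co p' ∧ S.deg p' = S.deg x) →
          (∀ m, m ≤ (S.matW v ^ m) p p') → False := by
        intro p p' v hp hp' hm
        have o := S.Od_deg (hk p' hp'.1)
        rw [hp'.2, hd'] at o
        have := S.deg_le (S.no_pump o v hm)
        omega
      obtain ⟨K, hK⟩ := Bdd.core S.matW S.matW_nil S.matW_append
        (fun p => S.Co p ∧ S.deg p = S.deg x)
        (by
          intro p s r u v hp hr hu hv
          have cs : S.Co s := Co.pred S hv hr.1
          have a1 := S.deg_mono hu (hk s cs)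
          have a2 := S.deg_mono hv (hk r hr.1)
          exact ⟨cs, by omega⟩)
        (by
          intro p v hp
          by_contra hc
          exact pump p p v hp hp fun m => by
            have := heavy_pow S (S.matW v) p (by omega) m
            omega)
        (by
          intro p p' v hp hp' hne a b c
          exact pump p p' v hp hp' (barbell_pow S (S.matW v) p p' hne a b c))
        x ⟨cx, rfl⟩ y ⟨cy, hd⟩
      exact ⟨K, fun _ _ _ _ => hK⟩
    · exact ⟨0, fun a b c d => absurd ⟨a, b, c, d⟩ hh⟩
  choose Kf hKf using key
  exact ⟨∑ z, Kf z, fun y x a b c d w => le_trans (hKf (y, x) a b c d w)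
    (Finset.single_le_sum (f := Kf) (fun _ _ => Nat.zero_le _) (Finset.mem_univ (y, x)))⟩

/-! ### The bounded SST -/

/-- The registers kept in the new machine. -/
abbrev Keep : Type := {x : S.X // S.Co x ∧ ¬ S.Od 0 x}

noncomputable instance : Fintype S.Keep := by
  classical
  exact inferInstanceAs (Fintype {x : S.X // S.Co x ∧ ¬ S.Od 0 x})

open Classical in
/-- A register of `S` as a word of the new machine, in state `q`. -/
noncomputable def dec {L : ℕ} (q : S.X → {l : List B // l.length ≤ L}) (y : S.X) :
    List (B ⊕ S.Keep) :=
  if S.Od 0 y then (q y).1.map Sum.inl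
  else if h : S.Co y ∧ ¬ S.Od 0 y then [Sum.inr ⟨y, h⟩] else []

open Classical in
/-- The state component storing bounded registers. -/
noncomputable def store (L : ℕ) (v : S.X → List B) : S.X → {l : List B // l.length ≤ L} :=
  fun x => ⟨if S.Od 0 x then (v x).take L else [], by split_ifs <;> simp⟩

/-- The new machine. -/
noncomputable def toSST [Finite B] (L : ℕ) : SST A B :=
  haveI : Finite {l : List B // l.length ≤ L} := (List.finite_length_le B L).to_subtype
  { Q := S.X → {l : List B // l.length ≤ L}
    X := S.Keep
    finQ := Fintype.ofFinite _
    q0 := S.store L S.init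
    init := fun x => S.init x.1
    trans := fun q a => some (S.store L (fun x => (S.upd a x).flatMap (fun y => (q y).1)),
      fun x => (S.upd a x.1).flatMap (S.dec q))
    out := fun q => some (S.out.flatMap (S.dec q)) }

theorem mat_pos {a : A} {x y : S.X} (h : y ∈ S.upd a x) : 1 ≤ S.matW [a] y x := by
  rw [matW_singleton]
  exact List.count_pos_iff.2 h

theorem evalSubst_dec {L : ℕ} (q : S.X → {l : List B // l.length ≤ L}) (v : S.Keep → List B)
    (V : S.X → List B) (hq : ∀ x, S.Od 0 x → (q x).1 = V x) (hv : ∀ x : S.Keep, v x = V x.1)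
    (l : List S.X) (hl : ∀ y ∈ l, S.Co y) : evalSubst v (l.flatMap (S.dec q)) = l.flatMap V := by
  induction l with
  | nil => rfl
  | cons z l ih =>
    have hz : S.Co z := hl z (by simp)
    have ih' := ih fun y hy => hl y (by simp [hy])
    simp only [evalSubst] at ih' ⊢
    rw [List.flatMap_cons, List.flatMap_append, ih', List.flatMap_cons]
    congr 1
    unfold dec
    by_cases h0 : S.Od 0 z
    · rw [if_pos h0, List.flatMap_map, ← hq z h0]
      simp
    · rw [if_neg h0, dif_pos ⟨hz, h0⟩]
      simp [hv]

theorem store_eq {L : ℕ} (hL : ∀ x, S.Od 0 x → ∀ w, (S.val w x).length ≤ L)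
    (v : S.X → List B) (w : List A) (x : S.X) (h0 : S.Od 0 x) (hv : v x = S.val w x) :
    (S.store L v x).1 = S.val w x := by
  simp only [store, if_pos h0, hv]
  exact List.take_of_length_le (hL x h0 w)

theorem runFrom_toSST [Finite B] {L : ℕ} (hL : ∀ x, S.Od 0 x → ∀ w, (S.val w x).length ≤ L)
    (w : List A) : ∀ (w0 : List A) (q : S.X → {l : List B // l.length ≤ L})
      (v : S.Keep → List B), (∀ x, S.Od 0 x → (q x).1 = S.val w0 x) →
      (∀ x : S.Keep, v x = S.val w0 x.1) →
      ∃ (q' : S.X → {l : List B // l.length ≤ L}) (v' : S.Keep → List B),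
        (S.toSST L).runFrom q v w = some (q', v') ∧
        (∀ x, S.Od 0 x → (q' x).1 = S.val (w0 ++ w) x) ∧
        (∀ x : S.Keep, v' x = S.val (w0 ++ w) x.1) := by
  induction w with
  | nil =>
    intro w0 q v hq hv
    refine ⟨q, v, rfl, ?_, ?_⟩ <;> rw [List.append_nil] <;> assumption
  | cons a w ih =>
    intro w0 q v hq hv
    obtain ⟨q', v', h1, h2, h3⟩ := ih (w0 ++ [a])
      (S.store L (fun x => (S.upd a x).flatMap (fun y => (q y).1)))
      (fun x => evalSubst v ((S.upd a x.1).flatMap (S.dec q)))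
      (by
        intro x hx
        refine S.store_eq hL _ _ x hx ?_
        rw [val_snoc]
        refine List.flatMap_congr fun y hy => ?_
        exact hq y (Od.pred S (S.mat_pos hy) hx))
      (by
        intro x
        rw [val_snoc]
        exact S.evalSubst_dec q v _ hq hv _ fun y hy => Co.pred S (S.mat_pos hy) x.2.1)
    refine ⟨q', v', h1, ?_, ?_⟩
    · intro x hx; rw [h2 x hx]; simp
    · intro x; rw [h3 x]; simp

theorem eval_toSST [Finite B] {L : ℕ} (hL : ∀ x, S.Od 0 x → ∀ w, (S.val w x).length ≤ L)
    (w : List A) : (S.toSST L).eval w = some (S.eval w) := by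
  obtain ⟨q', v', h1, h2, h3⟩ := S.runFrom_toSST hL w [] (S.store L S.init) (fun x => S.init x.1)
    (fun x hx => S.store_eq hL _ [] x hx rfl) (fun x => rfl)
  have : (S.toSST L).eval w = some (evalSubst v' (S.out.flatMap (S.dec q'))) := by
    unfold SST.eval
    have h1' : (S.toSST L).runFrom (S.toSST L).q0 (S.toSST L).init w = some (q', v') := h1
    rw [h1']
    rfl
  rw [this, S.evalSubst_dec q' v' (S.val w) h2 h3]
  · rfl
  · intro y hy
    exact ⟨[], y, hy, by rw [matW_nil]; simp⟩

theorem occCount_flatMap {X Y Z : Type} (x : X) (l : List Y) (f : Y → List (Z ⊕ X)) :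
    occCount x (l.flatMap f) = (l.map fun y => occCount x (f y)).sum := by
  unfold occCount
  rw [List.countP_flatMap]
  rfl

theorem occCount_dec {L : ℕ} (q : S.X → {l : List B // l.length ≤ L}) (y : S.Keep) (z : S.X) :
    occCount y (S.dec q z) = if z = y.1 then 1 else 0 := by
  unfold dec occCount
  by_cases h0 : S.Od 0 z
  · have : z ≠ y.1 := fun h => y.2.2 (h ▸ h0)
    rw [if_pos h0, if_neg this]
    simp [List.countP_map]
  · rw [if_neg h0]
    by_cases h : S.Co z ∧ ¬ S.Od 0 z
    · rw [dif_pos h]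
      by_cases hz : z = y.1
      · subst hz
        simp
      · rw [if_neg hz, List.countP_eq_zero]
        intro c hc
        simp only [List.mem_singleton] at hc
        subst hc
        simp only [decide_eq_true_eq, Sum.inr.injEq]
        intro he
        exact hz (congrArg Subtype.val he)
    · rw [dif_neg h, if_neg]
      · rfl
      · rintro rfl
        exact h y.2

theorem occCount_step {L : ℕ} (q : S.X → {l : List B // l.length ≤ L}) (a : A) (y x : S.Keep) :
    occCount y ((S.upd a x.1).flatMap (S.dec q)) = S.mat a y.1 x.1 := by
  rw [occCount_flatMap, mat]
  simp only [occCount_dec]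
  induction S.upd a x.1 with
  | nil => simp
  | cons z l ih =>
    rw [List.map_cons, List.sum_cons, ih, List.count_cons, add_comm]
    simp

theorem occCount_applySubst {X : Type} [Fintype X] (s : X → List (B ⊕ X)) (l : List (B ⊕ X))
    (y : X) : occCount y (applySubst s l) = ∑ z, occCount z l * occCount y (s z) := by
  classical
  unfold applySubst
  rw [occCount_flatMap]
  induction l with
  | nil => simp [occCount]
  | cons c l ih =>
    rw [List.map_cons, List.sum_cons, ih]
    have e : ∀ z, occCount z (c :: l) = occCount z l + if c = Sum.inr z then 1 else 0 := by
      intro z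
      unfold occCount
      rw [List.countP_cons]
      simp
    simp only [e, add_mul, Finset.sum_add_distrib]
    rw [add_comm]
    congr 1
    cases c with
    | inl b => simp [occCount]
    | inr x => simp

theorem occCount_substFrom [Finite B] {L : ℕ} (w : List A) :
    ∀ (q : (S.toSST L).Q) (p : (S.toSST L).Q × (S.Keep → List (B ⊕ S.Keep))),
      (S.toSST L).substFrom q w = some p →
      ∀ y x : S.Keep, occCount y (p.2 x) ≤ S.matW w y.1 x.1 := by
  classical
  induction w with
  | nil =>
    intro q p hp y x
    have hp' : p = (q, fun x => [Sum.inr x]) := (Option.some.inj hp).symm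
    subst hp'
    simp only [occCount, matW_nil, Matrix.one_apply]
    split_ifs with h
    · exact List.countP_le_length
    · rw [Nat.le_zero, List.countP_eq_zero]
      intro c hc
      simp only [List.mem_singleton] at hc
      subst hc
      simp only [decide_eq_true_eq, Sum.inr.injEq]
      intro he
      exact h (congrArg Subtype.val he).symm
  | cons a w ih =>
    intro q p hp y x
    have hp' : ((S.toSST L).substFrom
        (S.store L (fun x => (S.upd a x).flatMap (fun y => (q y).1))) w).map
        (fun p => (p.1, fun x => applySubst
          (fun x : S.Keep => (S.upd a x.1).flatMap (S.dec q)) (p.2 x))) = some p := hp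
    obtain ⟨p0, h0, rfl⟩ := Option.map_eq_some_iff.1 hp'
    have ih' := ih _ _ h0
    show occCount y (applySubst _ (p0.2 x)) ≤ _
    refine le_trans (le_of_eq (occCount_applySubst (X := S.Keep) _ (p0.2 x) y)) ?_
    rw [matW_cons, Matrix.mul_apply]
    calc ∑ z : S.Keep, occCount z (p0.2 x) * occCount y ((S.upd a z.1).flatMap (S.dec q))
        ≤ ∑ z : S.Keep, S.mat a y.1 z.1 * S.matW w z.1 x.1 := by
          refine Finset.sum_le_sum fun z _ => ?_
          have e1 := S.occCount_step (L := L) q a y z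
          exact (Nat.mul_le_mul (ih' z x) e1.le).trans (le_of_eq (mul_comm _ _))
      _ = ∑ z ∈ Finset.univ.image (fun z : S.Keep => z.1), S.mat a y.1 z * S.matW w z x.1 := by
          rw [Finset.sum_image]
          intro a _ b _ hab
          exact Subtype.ext hab
      _ ≤ _ := Finset.sum_le_sum_of_subset (Finset.subset_univ _)

theorem mem_of_inr_mem {L : ℕ} (q : S.X → {l : List B // l.length ≤ L}) (l : List S.X)
    (y : S.Keep) (h : Sum.inr y ∈ l.flatMap (S.dec q)) : y.1 ∈ l := by
  rw [List.mem_flatMap] at h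
  obtain ⟨z, hz, hy⟩ := h
  unfold dec at hy
  split_ifs at hy with h0 h1
  · simp at hy
  · simp only [List.mem_singleton, Sum.inr.injEq] at hy
    rw [hy]
    exact hz
  · simp at hy

end SimpleSST

theorem stmt16 {A B : Type} [Fintype A] [Fintype B] (S : SimpleSST A B) (k : ℕ)
    (h : PolyGrowth (fun w => (S.eval w).length) (k + 1)) :
    ∃ (Bd : ℕ) (T : SST A B), T.IsBounded k Bd ∧ ∀ w, T.eval w = some (S.eval w) := by
  classical
  have hk : ∀ x, S.Co x → S.Od (k+1) x := fun x hx => SimpleSST.Co.Od S h.1 hx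
  obtain ⟨K, hK⟩ := S.exists_bound hk
  obtain ⟨L, hL⟩ : ∃ L, ∀ x, S.Od 0 x → ∀ w, (S.val w x).length ≤ L := by
    have : ∀ x, ∃ L, S.Od 0 x → ∀ w, (S.val w x).length ≤ L := by
      intro x
      by_cases hx : S.Od 0 x
      · obtain ⟨C, hC⟩ := hx
        exact ⟨C, fun _ w => by simpa using hC w⟩
      · exact ⟨0, fun h => absurd h hx⟩
    choose Lf hLf using this
    exact ⟨∑ x, Lf x, fun x hx w => (hLf x hx w).trans
      (Finset.single_le_sum (f := Lf) (fun _ _ => Nat.zero_le _) (Finset.mem_univ x))⟩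
  have hdeg : ∀ x : S.Keep, 1 ≤ S.deg x.1 ∧ S.deg x.1 ≤ k + 1 := by
    intro x
    refine ⟨?_, S.deg_le (hk _ x.2.1)⟩
    by_contra hc
    have h0 : S.deg x.1 = 0 := by omega
    have := S.Od_deg (hk _ x.2.1)
    rw [h0] at this
    exact x.2.2 this
  refine ⟨Fintype.card S.Keep * K, S.toSST L, ⟨fun x : S.Keep => ⟨S.deg x.1 - 1, ?_⟩, ?_, ?_⟩,
    S.eval_toSST hL⟩
  · have := hdeg x
    omega
  · intro q a p hp x y hxy
    have hp' : p = (S.store L (fun x => (S.upd a x).flatMap (fun y => (q y).1)),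
      fun x => (S.upd a x.1).flatMap (S.dec q)) := (Option.some.inj hp).symm
    subst hp'
    have hmem := S.mem_of_inr_mem q _ y hxy
    have := S.deg_mono (S.mat_pos hmem) (hk _ x.2.1)
    show S.deg y.1 - 1 ≤ S.deg x.1 - 1
    omega
  · intro q w p hp y
    refine le_trans (Finset.sum_le_card_nsmul _ _ K ?_) ?_
    · intro x hx
      have hx' := (Finset.mem_filter.1 hx).2
      have hx'' : S.deg x.1 - 1 = S.deg y.1 - 1 := congrArg Fin.val hx'
      have a1 := hdeg x
      have a2 := hdeg y
      refine (S.occCount_substFrom w q p hp y x).trans ?_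
      exact hK y.1 x.1 y.2.1 x.2.1 (by omega) a1.1 w
    · rw [smul_eq_mul]
      exact Nat.mul_le_mul_right _ (Finset.card_le_univ _)
end

section
/- For every (k,B)-bounded streaming string transducer there exists a k-layered streaming string transducer computing the same function. -/
set_option autoImplicit false

section LayerAux
open scoped Classical

/-- Classical counting of occurrences. -/
noncomputable def List.kcnt {α : Type} (l : List α) (a : α) : ℕ := l.count a

@[simp] theorem List.kcnt_nil {α : Type} (a : α) : ([] : List α).kcnt a = 0 := rfl

theorem List.kcnt_cons {α : Type} (a b : α) (l : List α) :
    (b :: l).kcnt a = l.kcnt a + if b = a then 1 else 0 := by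
  simp [List.kcnt, List.count_cons]

theorem List.kcnt_append {α : Type} (a : α) (l l' : List α) :
    (l ++ l').kcnt a = l.kcnt a + l'.kcnt a := by
  simp [List.kcnt]

theorem List.kcnt_pos_iff {α : Type} {a : α} {l : List α} : 0 < l.kcnt a ↔ a ∈ l := by
  simp [List.kcnt, List.count_pos_iff]

theorem List.kcnt_eq_zero {α : Type} {a : α} {l : List α} : l.kcnt a = 0 ↔ a ∉ l := by
  simp [List.kcnt, List.count_eq_zero]

theorem List.nodup_iff_kcnt {α : Type} {l : List α} : l.Nodup ↔ ∀ a, l.kcnt a ≤ 1 := by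
  simp [List.kcnt, List.nodup_iff_count_le_one]

theorem List.kcnt_map {α β : Type} (f : α → β) (hf : Function.Injective f) (l : List α) (a : α) :
    (l.map f).kcnt (f a) = l.kcnt a := by
  simp only [List.kcnt]
  exact List.count_map_of_injective _ _ hf _

/-! ### Branching linear steps -/

/-- A branching step: each node `c` at the current level has a parent node `p c` at the previous
level and a substitution `t c` describing its registers in terms of those of the parent. -/
structure LStep (V Z D : Type) where
  p : V → V
  t : V → Z → List (D ⊕ Z)

def lval {V Z D : Type} : List (LStep V Z D) → V → Z → List D
  | [], _, _ => []
  | s :: S, c, z => evalSubst (lval S (s.p c)) (s.t c z)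

noncomputable def scnt {V Z D : Type} [Fintype V] [Fintype Z] (d : D) (s : LStep V Z D) : ℕ :=
  ∑ c, ∑ z, (s.t c z).kcnt (Sum.inl d)

def SLin {V Z D : Type} [Fintype Z] (s : LStep V Z D) : Prop :=
  ∀ c z', ∑ z, (s.t c z).kcnt (Sum.inr z') ≤ 1

theorem evalSubst_nil {B X : Type} (v : X → List B) : evalSubst v [] = [] := rfl

theorem evalSubst_inl {B X : Type} (v : X → List B) (b : B) (l : List (B ⊕ X)) :
    evalSubst v (Sum.inl b :: l) = b :: evalSubst v l := rfl

theorem evalSubst_inr {B X : Type} (v : X → List B) (x : X) (l : List (B ⊕ X)) :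
    evalSubst v (Sum.inr x :: l) = v x ++ evalSubst v l := rfl

theorem evalSubst_append {B X : Type} (v : X → List B) (l l' : List (B ⊕ X)) :
    evalSubst v (l ++ l') = evalSubst v l ++ evalSubst v l' := by
  simp [evalSubst]

theorem applySubst_inl {B X : Type} (v : X → List (B ⊕ X)) (b : B) (l : List (B ⊕ X)) :
    applySubst v (Sum.inl b :: l) = Sum.inl b :: applySubst v l := rfl

theorem applySubst_inr {B X : Type} (v : X → List (B ⊕ X)) (x : X) (l : List (B ⊕ X)) :
    applySubst v (Sum.inr x :: l) = v x ++ applySubst v l := rfl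

theorem evalSubst_applySubst {B X : Type} (v : X → List B) (g : X → List (B ⊕ X))
    (l : List (B ⊕ X)) :
    evalSubst v (applySubst g l) = evalSubst (fun z => evalSubst v (g z)) l := by
  induction l with
  | nil => rfl
  | cons a l ih =>
    cases a with
    | inl b => rw [applySubst_inl, evalSubst_inl, evalSubst_inl, ih]
    | inr x => rw [applySubst_inr, evalSubst_append, evalSubst_inr, ih]

theorem count_applySubst_inl {D Z : Type} [Fintype Z] (g : Z → List (D ⊕ Z)) (d : D)
    (l : List (D ⊕ Z)) :
    (applySubst g l).kcnt (Sum.inl d) =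
      l.kcnt (Sum.inl d) + ∑ z, l.kcnt (Sum.inr z) * (g z).kcnt (Sum.inl d) := by
  induction l with
  | nil => simp [applySubst]
  | cons a l ih =>
    cases a with
    | inl b =>
      rw [applySubst_inl, List.kcnt_cons, ih, List.kcnt_cons]
      simp [List.kcnt_cons]
      omega
    | inr x =>
      rw [applySubst_inr, List.kcnt_append, ih]
      simp [List.kcnt_cons, add_mul, Finset.sum_add_distrib]
      omega

theorem count_applySubst_inr {D Z : Type} [Fintype Z] (g : Z → List (D ⊕ Z)) (z0 : Z)
    (l : List (D ⊕ Z)) :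
    (applySubst g l).kcnt (Sum.inr z0) =
      ∑ z, l.kcnt (Sum.inr z) * (g z).kcnt (Sum.inr z0) := by
  induction l with
  | nil => simp [applySubst]
  | cons a l ih =>
    cases a with
    | inl b =>
      rw [applySubst_inl, List.kcnt_cons, ih]
      simp [List.kcnt_cons]
    | inr x =>
      rw [applySubst_inr, List.kcnt_append, ih]
      simp [List.kcnt_cons, add_mul, Finset.sum_add_distrib]
      omega

/-- Merging two consecutive steps, keeping only the nodes of `U`. -/
noncomputable def mergeStep {V Z D : Type} (U : Finset V) (s s' : LStep V Z D) : LStep V Z D where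
  p c := s'.p (s.p c)
  t c z := if c ∈ U then applySubst (s'.t (s.p c)) (s.t c z) else []

theorem sum_mul_le_of_lin {Z : Type} [Fintype Z] (m : Z → Z → ℕ) (n : Z → ℕ)
    (h : ∀ z', ∑ z, m z z' ≤ 1) : ∑ z, ∑ z', m z z' * n z' ≤ ∑ z', n z' := by
  rw [Finset.sum_comm]
  apply Finset.sum_le_sum
  intro z' _
  rw [← Finset.sum_mul]
  calc _ ≤ 1 * n z' := Nat.mul_le_mul_right _ (h z')
    _ = _ := one_mul _

theorem mergeStep_lin {V Z D : Type} [Fintype Z] (U : Finset V) (s s' : LStep V Z D)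
    (hs : SLin s) (hs' : SLin s') : SLin (mergeStep U s s') := by
  intro c z'
  by_cases hc : c ∈ U
  · simp only [mergeStep, hc, if_true, count_applySubst_inr]
    exact (sum_mul_le_of_lin _ _ (hs c)).trans (hs' _ _)
  · simp [mergeStep, hc]

theorem mergeStep_scnt {V Z D : Type} [Fintype V] [Fintype Z] (U : Finset V) (s s' : LStep V Z D)
    (hs : SLin s) (hinj : Set.InjOn s.p U) (d : D) :
    scnt d (mergeStep U s s') ≤ scnt d s + scnt d s' := by
  have h1 : scnt d (mergeStep U s s') ≤
      ∑ c ∈ U, ((∑ z, (s.t c z).kcnt (Sum.inl d)) +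
        ∑ z, (s'.t (s.p c) z).kcnt (Sum.inl d)) := by
    unfold scnt
    rw [← Finset.sum_subset (Finset.subset_univ U)]
    · apply Finset.sum_le_sum
      intro c hc
      simp only [mergeStep, hc, if_true, count_applySubst_inl, Finset.sum_add_distrib]
      exact Nat.add_le_add_left (sum_mul_le_of_lin _ _ (hs c)) _
    · intro c _ hc
      simp [mergeStep, hc]
  refine h1.trans ?_
  rw [Finset.sum_add_distrib]
  apply Nat.add_le_add
  · exact Finset.sum_le_sum_of_subset (Finset.subset_univ U)
  · rw [← Finset.sum_image (f := fun c => ∑ z, (s'.t c z).kcnt (Sum.inl d)) hinj]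
    exact Finset.sum_le_sum_of_subset (Finset.subset_univ _)

theorem compress {V Z D : Type} [Fintype V] [Fintype Z] : ∀ (S : List (LStep V Z D)) (U : Finset V),
    (∀ s ∈ S, SLin s) → U.card + 1 ≤ S.length →
    ∃ S' : List (LStep V Z D), S'.length + 1 = S.length ∧ (∀ s ∈ S', SLin s) ∧
      (∀ d, (S'.map (scnt d)).sum ≤ (S.map (scnt d)).sum) ∧
      ∀ c ∈ U, ∀ z, lval S' c z = lval S c z := by
  intro S
  induction S with
  | nil => intro U _ h; simp at h
  | cons s S ih =>
    intro U hl hU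
    by_cases hinj : Set.InjOn s.p U
    · cases S with
      | nil =>
        have : U = ∅ := by
          rw [← Finset.card_eq_zero]; simp at hU; simpa using hU
        subst this
        exact ⟨[], by simp⟩
      | cons s' S =>
        refine ⟨mergeStep U s s' :: S, by simp, ?_, ?_, ?_⟩
        · intro x hx
          rcases List.mem_cons.1 hx with rfl | hx
          · exact mergeStep_lin _ _ _ (hl _ (by simp)) (hl _ (by simp))
          · exact hl _ (by simp [hx])
        · intro d
          have := mergeStep_scnt U s s' (hl _ (by simp)) hinj d
          simp only [List.map_cons, List.sum_cons]
          omega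
        · intro c hc z
          simp only [lval, mergeStep, hc, if_true, evalSubst_applySubst]
    · have hlt : (U.image s.p).card < U.card := by
        refine lt_of_le_of_ne Finset.card_image_le ?_
        intro h
        exact hinj (Finset.card_image_iff.1 h)
      obtain ⟨S', h1, h2, h3, h4⟩ := ih (U.image s.p) (fun x hx => hl x (by simp [hx]))
        (by simp at hU; omega)
      refine ⟨s :: S', by simp [h1], ?_, ?_, ?_⟩
      · intro x hx
        rcases List.mem_cons.1 hx with rfl | hx
        · exact hl _ (by simp)
        · exact h2 _ hx
      · intro d
        have := h3 d
        simp only [List.map_cons, List.sum_cons]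
        omega
      · intro c hc z
        have : lval S' (s.p c) = lval S (s.p c) := by
          funext z'
          exact h4 _ (Finset.mem_image_of_mem _ hc) z'
        simp only [lval, this]

theorem scnt_of_mem_lval {V Z D : Type} [Fintype V] [Fintype Z] (d : D) :
    ∀ (S : List (LStep V Z D)) (c : V) (z : Z), d ∈ lval S c z → 0 < (S.map (scnt d)).sum := by
  intro S
  induction S with
  | nil => intro c z h; simp [lval] at h
  | cons s S ih =>
    intro c z h
    simp only [lval, evalSubst, List.mem_flatMap] at h
    obtain ⟨e, he, hd⟩ := h
    simp only [List.map_cons, List.sum_cons]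
    cases e with
    | inl b =>
      simp at hd
      subst hd
      have h1 : 0 < (s.t c z).kcnt (Sum.inl d) := List.kcnt_pos_iff.2 he
      have h2 : (s.t c z).kcnt (Sum.inl d) ≤ ∑ z, (s.t c z).kcnt (Sum.inl d) :=
        Finset.single_le_sum (f := fun z => (s.t c z).kcnt (Sum.inl d)) (by simp)
          (Finset.mem_univ z)
      have h3 : ∑ z, (s.t c z).kcnt (Sum.inl d) ≤ scnt d s :=
        Finset.single_le_sum (f := fun c => ∑ z, (s.t c z).kcnt (Sum.inl d)) (by simp)
          (Finset.mem_univ c)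
      omega
    | inr y =>
      have := ih _ _ hd
      omega

/-! ### Shapes -/

/-- The finite shape of a linear step. -/
def Sh (V Z : Type) [Fintype Z] : Type :=
  {s : (V → V) × (V → Z → {l : List Z // l.Nodup}) // ∀ c z', ∑ z, (s.2 c z).1.kcnt z' ≤ 1}

noncomputable instance {V Z : Type} [Fintype V] [Fintype Z] : Fintype (Sh V Z) := by
  unfold Sh
  infer_instance

def instS {V Z D : Type} [Fintype Z] (sh : Sh V Z) (f : V × (Z ⊕ Z) → List D) : LStep V Z D where
  p := sh.1.1
  t c z := (f (c, Sum.inl z)).map Sum.inl ++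
    (sh.1.2 c z).1.flatMap (fun z' => Sum.inr z' :: (f (c, Sum.inr z')).map Sum.inl)

theorem instS_lin {V Z D : Type} [Fintype Z] (sh : Sh V Z) (f : V × (Z ⊕ Z) → List D) :
    SLin (instS sh f) := by
  intro c z'
  refine le_trans (le_of_eq ?_) (sh.2 c z')
  refine Finset.sum_congr rfl fun z _ => ?_
  have hmap : ∀ l : List D, (l.map (Sum.inl : D → D ⊕ Z)).kcnt (Sum.inr z') = 0 := by
    intro l; rw [List.kcnt_eq_zero]; simp
  simp only [instS, List.kcnt_append, hmap, zero_add]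
  induction (sh.1.2 c z).1 with
  | nil => rfl
  | cons a l ih =>
    simp only [List.flatMap_cons, List.kcnt_append, ih, List.kcnt_cons, hmap]
    simp
    omega

theorem instS_scnt {V Z D : Type} [Fintype V] [Fintype Z] (sh : Sh V Z)
    (f : V × (Z ⊕ Z) → List D) (d : D) :
    scnt d (instS sh f) ≤ ∑ P, (f P).kcnt d := by
  rw [Fintype.sum_prod_type]
  unfold scnt
  apply Finset.sum_le_sum
  intro c _
  rw [Fintype.sum_sum_type]
  have hmap : ∀ l : List D, (l.map (Sum.inl : D → D ⊕ Z)).kcnt (Sum.inl d) = l.kcnt d := by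
    intro l; exact List.kcnt_map Sum.inl Sum.inl_injective _ _
  have key : ∀ z, ((instS sh f).t c z).kcnt (Sum.inl d) = (f (c, Sum.inl z)).kcnt d +
      ∑ z', (sh.1.2 c z).1.kcnt z' * (f (c, Sum.inr z')).kcnt d := by
    intro z
    simp only [instS, List.kcnt_append, hmap]
    congr 1
    induction (sh.1.2 c z).1 with
    | nil => simp
    | cons a l ih =>
      simp only [List.flatMap_cons, List.kcnt_append, ih, List.kcnt_cons, hmap]
      simp [add_mul, Finset.sum_add_distrib]
      omega
  simp only [key, Finset.sum_add_distrib]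
  exact Nat.add_le_add_left (sum_mul_le_of_lin _ _ (sh.2 c)) _

/-- Applying a morphism to the letters. -/
theorem evalSubst_flatMap {D D' Z : Type} (g : D → List D') (h : Z → List D) (l : List (D ⊕ Z)) :
    (evalSubst h l).flatMap g = l.flatMap (Sum.elim g (fun z => (h z).flatMap g)) := by
  induction l with
  | nil => rfl
  | cons a l ih =>
    cases a with
    | inl b => simp [evalSubst_inl, ih]
    | inr x => simp [evalSubst_inr, ih]

theorem evalSubst_eq {B X : Type} (v : X → List B) (l : List (B ⊕ X)) :
    evalSubst v l = l.flatMap (Sum.elim (fun b => [b]) v) := by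
  induction l with
  | nil => rfl
  | cons a l ih =>
    cases a with
    | inl b => simp [evalSubst_inl, ih]
    | inr x => simp [evalSubst_inr, ih]

theorem evalSubst_map_inl {B X : Type} (v : X → List B) (l : List B) :
    evalSubst v (l.map Sum.inl) = l := by
  induction l with
  | nil => rfl
  | cons a l ih => simp [evalSubst_inl, ih]

theorem evalSubst_instS {V Z D : Type} [Fintype Z] (sh : Sh V Z) (f : V × (Z ⊕ Z) → List D)
    (h : Z → List D) (c : V) (z : Z) :
    evalSubst h ((instS sh f).t c z) = f (c, Sum.inl z) ++
      (sh.1.2 c z).1.flatMap (fun z' => h z' ++ f (c, Sum.inr z')) := by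
  simp only [instS, evalSubst_append, evalSubst_map_inl]
  congr 1
  induction (sh.1.2 c z).1 with
  | nil => rfl
  | cons a l ih =>
    simp [evalSubst_append, evalSubst_inr, evalSubst_map_inl, ih]

theorem lval_inst_flatMap {V Z D D' : Type} [Fintype Z] (g : D → List D') : ∀ (n : ℕ)
    (sh : Fin n → Sh V Z) (f : Fin n → V × (Z ⊕ Z) → List D) (c : V) (z : Z),
    (lval (List.ofFn fun l => instS (sh l) (f l)) c z).flatMap g =
      lval (List.ofFn fun l => instS (sh l) (fun P => (f l P).flatMap g)) c z := by
  intro n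
  induction n with
  | zero => intro sh f c z; simp [lval]
  | succ n ih =>
    intro sh f c z
    simp only [List.ofFn_succ, lval, evalSubst_instS, List.flatMap_append, List.flatMap_assoc, ih]
    rfl

/-! ### Normalization -/

def leadW {D Z : Type} : List (D ⊕ Z) → List D
  | [] => []
  | Sum.inl d :: w => d :: leadW w
  | Sum.inr _ :: _ => []

noncomputable def afterW {D Z : Type} (z' : Z) : List (D ⊕ Z) → List D
  | [] => []
  | Sum.inl _ :: w => afterW z' w
  | Sum.inr z :: w => if z = z' then leadW w else afterW z' w

def holesW {D Z : Type} : List (D ⊕ Z) → List Z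
  | [] => []
  | Sum.inl _ :: w => holesW w
  | Sum.inr z :: w => z :: holesW w

theorem count_holesW {D Z : Type} (z : Z) (w : List (D ⊕ Z)) :
    (holesW w).kcnt z = w.kcnt (Sum.inr z) := by
  induction w with
  | nil => rfl
  | cons a w ih =>
    cases a with
    | inl d => simp [holesW, ih, List.kcnt_cons]
    | inr x => simp [holesW, ih, List.kcnt_cons]

theorem normW {D Z : Type} (w : List (D ⊕ Z)) (h : (holesW w).Nodup) :
    (leadW w).map Sum.inl ++
      (holesW w).flatMap (fun z' => Sum.inr z' :: (afterW z' w).map Sum.inl) = w := by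
  induction w with
  | nil => rfl
  | cons a w ih =>
    cases a with
    | inl d =>
      simp only [leadW, holesW, afterW, List.map_cons, List.cons_append] at h ⊢
      rw [ih h]
    | inr x =>
      simp only [leadW, holesW, afterW, List.map_nil, List.nil_append, List.flatMap_cons,
        List.nodup_cons, if_true, List.cons_append] at h ⊢
      congr 1
      conv_rhs => rw [← ih h.2]
      congr 1
      apply List.flatMap_congr
      intro z' hz'
      have : x ≠ z' := fun e => h.1 (e ▸ hz')
      simp [this]

theorem count_normW {D Z : Type} [Fintype Z] (d : D) (w : List (D ⊕ Z)) :
    (leadW w).kcnt d + ∑ z', (afterW z' w).kcnt d ≤ w.kcnt (Sum.inl d) := by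
  induction w with
  | nil => simp [leadW, afterW]
  | cons a w ih =>
    cases a with
    | inl d' =>
      simp only [leadW, afterW, List.kcnt_cons]
      simp
      omega
    | inr x =>
      simp only [leadW, afterW, List.kcnt_cons]
      have : ∑ z', (if x = z' then leadW w else afterW z' w).kcnt d ≤
          ∑ z', ((if x = z' then (leadW w).kcnt d else 0) + (afterW z' w).kcnt d) := by
        apply Finset.sum_le_sum
        intro z' _
        split_ifs <;> omega
      rw [Finset.sum_add_distrib] at this
      simp at this ⊢
      omega

theorem normalize_step {V Z D : Type} [Fintype V] [Fintype Z] (s : LStep V Z D) (hs : SLin s) :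
    ∃ (sh : Sh V Z) (f : V × (Z ⊕ Z) → List D), instS sh f = s ∧
      ∀ d, ∑ P, (f P).kcnt d ≤ scnt d s := by
  have hex : ∀ c z', ∃ z0, ∀ z, z' ∈ holesW (s.t c z) → z = z0 := by
    intro c z'
    by_cases h : ∃ z, z' ∈ holesW (s.t c z)
    · obtain ⟨z0, h0⟩ := h
      refine ⟨z0, fun z hz => ?_⟩
      by_contra hne
      have h1 := hs c z'
      have h2 := Finset.sum_le_sum_of_subset (f := fun z => (s.t c z).kcnt (Sum.inr z'))
        (Finset.subset_univ {z, z0})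
      rw [Finset.sum_pair hne] at h2
      have h3 : 0 < (s.t c z).kcnt (Sum.inr z') := by
        rw [← count_holesW]; exact List.kcnt_pos_iff.2 hz
      have h4 : 0 < (s.t c z0).kcnt (Sum.inr z') := by
        rw [← count_holesW]; exact List.kcnt_pos_iff.2 h0
      omega
    · exact ⟨z', fun z hz => absurd ⟨z, hz⟩ h⟩
  choose ch hch using hex
  have hnd : ∀ c z, (holesW (s.t c z)).Nodup := by
    intro c z
    rw [List.nodup_iff_kcnt]
    intro z'
    rw [count_holesW]
    exact (Finset.single_le_sum (f := fun z => (s.t c z).kcnt (Sum.inr z')) (by simp)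
      (Finset.mem_univ z)).trans (hs c z')
  refine ⟨⟨(s.p, fun c z => ⟨holesW (s.t c z), hnd c z⟩), ?_⟩,
    fun P => Sum.elim (fun z => leadW (s.t P.1 z)) (fun z' => afterW z' (s.t P.1 (ch P.1 z'))) P.2,
    ?_, ?_⟩
  · intro c z'
    simp only [count_holesW]
    exact hs c z'
  · have : ∀ c z, (leadW (s.t c z)).map Sum.inl ++ (holesW (s.t c z)).flatMap
        (fun z' => Sum.inr z' :: (afterW z' (s.t c (ch c z'))).map Sum.inl) = s.t c z := by
      intro c z
      conv_rhs => rw [← normW _ (hnd c z)]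
      congr 1
      apply List.flatMap_congr
      intro z' hz'
      rw [← hch c z' z hz']
    cases s with
    | mk p t =>
      simp only [instS, LStep.mk.injEq, true_and]
      funext c z
      exact this c z
  · intro d
    rw [Fintype.sum_prod_type]
    unfold scnt
    apply Finset.sum_le_sum
    intro c _
    rw [Fintype.sum_sum_type]
    simp only [Sum.elim_inl, Sum.elim_inr]
    calc _ ≤ ∑ z, (leadW (s.t c z)).kcnt d + ∑ z', ∑ z, (afterW z' (s.t c z)).kcnt d := by
          apply Nat.add_le_add_left
          apply Finset.sum_le_sum
          intro z' _
          exact Finset.single_le_sum (f := fun z => (afterW z' (s.t c z)).kcnt d) (by simp)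
            (Finset.mem_univ (ch c z'))
      _ = ∑ z, ((leadW (s.t c z)).kcnt d + ∑ z', (afterW z' (s.t c z)).kcnt d) := by
          rw [Finset.sum_add_distrib, Finset.sum_comm]
      _ ≤ _ := Finset.sum_le_sum fun z _ => count_normW d _

theorem normalizeList {V Z D : Type} [Fintype V] [Fintype Z] (n : ℕ) (S : List (LStep V Z D))
    (hn : S.length = n) (hS : ∀ s ∈ S, SLin s) :
    ∃ (sh : Fin n → Sh V Z) (f : Fin n → V × (Z ⊕ Z) → List D),
      List.ofFn (fun l => instS (sh l) (f l)) = S ∧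
      ∀ d, ∑ l, ∑ P, (f l P).kcnt d ≤ (S.map (scnt d)).sum := by
  subst hn
  have := fun l : Fin S.length => normalize_step (S.get l) (hS _ (List.get_mem _ _))
  choose sh f h1 h2 using this
  refine ⟨sh, f, ?_, ?_⟩
  · simp only [h1]
    exact List.ofFn_get S
  · intro d
    calc _ ≤ ∑ l, scnt d (S.get l) := Finset.sum_le_sum fun l _ => h2 l d
      _ = _ := by
        conv_rhs => rw [← List.ofFn_get S]
        rw [List.map_ofFn, List.sum_ofFn]
        rfl

/-! ### Labelling the occurrences -/

noncomputable def relW {D X : Type} (Bd : ℕ) : (X → ℕ) → List (D ⊕ X) → List (D ⊕ (X × Fin Bd))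
  | _, [] => []
  | o, Sum.inl d :: w => Sum.inl d :: relW Bd o w
  | o, Sum.inr y :: w =>
    (if h : o y < Bd then [Sum.inr (y, ⟨o y, h⟩)] else []) ++
      relW Bd (Function.update o y (o y + 1)) w

theorem relW_inl {D X : Type} (Bd : ℕ) (d : D) (w : List (D ⊕ X)) : ∀ (o : X → ℕ),
    (relW Bd o w).kcnt (Sum.inl d) = w.kcnt (Sum.inl d) := by
  induction w with
  | nil => intro o; rfl
  | cons a w ih =>
    intro o
    cases a with
    | inl d' => simp [relW, List.kcnt_cons, ih]
    | inr y =>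
      simp only [relW, List.kcnt_append, ih, List.kcnt_cons]
      split_ifs <;> simp_all [List.kcnt_cons]

theorem relW_inr {D X : Type} (Bd : ℕ) (y : X) (j : Fin Bd) (w : List (D ⊕ X)) : ∀ (o : X → ℕ),
    (relW Bd o w).kcnt (Sum.inr (y, j)) =
      if o y ≤ (j : ℕ) ∧ (j : ℕ) < o y + w.kcnt (Sum.inr y) then 1 else 0 := by
  induction w with
  | nil => intro o; simp [relW]
  | cons a w ih =>
    intro o
    cases a with
    | inl d' => simp [relW, List.kcnt_cons, ih]
    | inr x =>
      simp only [relW, List.kcnt_append, ih, List.kcnt_cons]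
      have hj := j.2
      by_cases hx : x = y
      · subst hx
        by_cases hlt : o x < Bd
        · simp only [hlt, dite_true, List.kcnt_cons, List.kcnt_nil, Function.update_self]
          by_cases hjj : o x = (j : ℕ)
          · have : (⟨o x, hlt⟩ : Fin Bd) = j := Fin.ext hjj
            have e1 : ¬ (o x + 1 ≤ (j : ℕ) ∧ (j : ℕ) < o x + 1 + w.kcnt (Sum.inr x)) := by omega
            have e2 : o x ≤ (j : ℕ) ∧ (j : ℕ) < o x + (w.kcnt (Sum.inr x) + 1) := by omega
            simp only [this, if_true, if_neg e1, if_pos e2]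
          · have : ¬ (⟨o x, hlt⟩ : Fin Bd) = j := fun h => hjj (congrArg Fin.val h)
            simp [this]
            split_ifs <;> omega
        · simp [hlt]
          split_ifs <;> omega
      · have hx' : y ≠ x := fun h => hx h.symm
        simp only [Function.update_of_ne hx', Sum.inr.injEq, hx, if_false, add_zero]
        split_ifs <;> simp_all [List.kcnt_cons]

theorem relW_flatMap {D X C : Type} (Bd : ℕ) (E : D → List C) (h : X × Fin Bd → List C)
    (g : X → List C) (w : List (D ⊕ X)) : ∀ (o : X → ℕ),
    (∀ y (j : ℕ), o y ≤ j → j < o y + w.kcnt (Sum.inr y) → ∃ hj : j < Bd, h (y, ⟨j, hj⟩) = g y) →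
    (relW Bd o w).flatMap (Sum.elim E h) = w.flatMap (Sum.elim E g) := by
  induction w with
  | nil => intro o _; rfl
  | cons a w ih =>
    intro o ho
    cases a with
    | inl d =>
      simp only [relW, List.flatMap_cons, Sum.elim_inl]
      rw [ih o]
      intro y j h1 h2
      exact ho y j h1 (by simpa [List.kcnt_cons] using h2)
    | inr x =>
      obtain ⟨hlt, hh⟩ := ho x (o x) le_rfl (by simp [List.kcnt_cons])
      simp only [relW, hlt, dite_true, List.flatMap_append, List.flatMap_cons, List.flatMap_nil,
        List.append_nil, Sum.elim_inr, hh]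
      rw [ih]
      intro y j h1 h2
      by_cases hy : y = x
      · subst hy
        simp only [Function.update_self] at h1 h2
        exact ho y j (by omega) (by simp [List.kcnt_cons]; omega)
      · rw [Function.update_of_ne hy] at h1 h2
        refine ho y j h1 ?_
        simp only [List.kcnt_cons]
        omega

theorem offsets_exist {Y X : Type} (n : Y → X → ℕ) (s : Finset Y) :
    ∃ o : Y → X → ℕ, ∀ y (j : ℕ),
      ∑ z ∈ s, (if o z y ≤ j ∧ j < o z y + n z y then 1 else 0) =
        if j < ∑ z ∈ s, n z y then 1 else 0 := by
  induction s using Finset.induction_on with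
  | empty => exact ⟨fun _ _ => 0, by simp⟩
  | insert a s ha ih =>
    obtain ⟨o, ho⟩ := ih
    refine ⟨Function.update o a (fun y => ∑ z ∈ s, n z y), fun y j => ?_⟩
    rw [Finset.sum_insert ha, Finset.sum_insert ha]
    have : ∑ z ∈ s, (if Function.update o a (fun y => ∑ z ∈ s, n z y) z y ≤ j ∧
        j < Function.update o a (fun y => ∑ z ∈ s, n z y) z y + n z y then 1 else 0) =
        ∑ z ∈ s, (if o z y ≤ j ∧ j < o z y + n z y then 1 else 0) := by
      apply Finset.sum_congr rfl
      intro z hz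
      have : z ≠ a := fun h => ha (h ▸ hz)
      rw [Function.update_of_ne this]
    rw [this, ho, Function.update_self]
    split_ifs <;> omega

theorem label_family {D X : Type} [Fintype X] (Bd : ℕ) (w : X × Fin Bd → List (D ⊕ X)) :
    ∃ w' : X × Fin Bd → List (D ⊕ (X × Fin Bd)),
      (∀ z0, ∑ z, (w' z).kcnt (Sum.inr z0) ≤ 1) ∧
      (∀ d z, (w' z).kcnt (Sum.inl d) = (w z).kcnt (Sum.inl d)) ∧
      (∀ {C : Type} (E : D → List C) (h : X × Fin Bd → List C) (g : X → List C),
        (∀ y, ∑ z, (w z).kcnt (Sum.inr y) ≤ Bd) →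
        (∀ y (j : Fin Bd), (j : ℕ) < ∑ z, (w z).kcnt (Sum.inr y) → h (y, j) = g y) →
        ∀ z, (w' z).flatMap (Sum.elim E h) = (w z).flatMap (Sum.elim E g)) := by
  obtain ⟨o, ho⟩ := offsets_exist (fun z y => (w z).kcnt (Sum.inr y)) Finset.univ
  refine ⟨fun z => relW Bd (o z) (w z), ?_, ?_, ?_⟩
  · rintro ⟨y, j⟩
    simp only [relW_inr]
    rw [ho]
    split_ifs <;> omega
  · intro d z
    exact relW_inl _ _ _ _
  · intro C E h g hB hg z
    apply relW_flatMap
    intro y j h1 h2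
    have h3 := ho y j
    have h4 := Finset.single_le_sum (s := Finset.univ)
      (f := fun z => if o z y ≤ j ∧ j < o z y + (w z).kcnt (Sum.inr y) then 1 else 0)
      (by simp) (Finset.mem_univ z)
    simp only [h1, h2, and_self, if_true] at h4
    rw [h3] at h4
    have h5 : j < ∑ z, (w z).kcnt (Sum.inr y) := by
      by_contra hn
      simp [hn] at h4
    have h6 : j < Bd := lt_of_lt_of_le h5 (hB y)
    exact ⟨h6, hg y ⟨j, h6⟩ h5⟩

theorem occCount_eq {B X : Type} (x : X) (l : List (B ⊕ X)) :
    occCount x l = l.kcnt (Sum.inr x) := by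
  induction l with
  | nil => rfl
  | cons a l ih =>
    rw [List.kcnt_cons, ← ih, occCount, List.countP_cons]
    simp [occCount]

/-! ### The simulation -/

abbrev VN (X : Type) (Bd : ℕ) : Type := X → Fin (Bd + 1)
abbrev ZN (X : Type) (Bd : ℕ) : Type := X × Fin Bd
abbrev RN (X : Type) (Bd n : ℕ) : Type := Fin n × (VN X Bd × (ZN X Bd ⊕ ZN X Bd))
abbrev XN (X : Type) (Bd n k : ℕ) : Type := Fin (k + 1) × RN X Bd n

/-- The symbolic content of a layer. -/
def tmpl {B X : Type} [Fintype X] {Bd n k : ℕ} (i : Fin (k + 1)) (sh : Fin n → Sh (VN X Bd) (ZN X Bd)) :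
    List (LStep (VN X Bd) (ZN X Bd) (B ⊕ XN X Bd n k)) :=
  List.ofFn fun l => instS (sh l) (fun P => [Sum.inr (i, (l, P))])

theorem tmpl_lin {B X : Type} [Fintype X] {Bd n k : ℕ} (i : Fin (k + 1))
    (sh : Fin n → Sh (VN X Bd) (ZN X Bd)) :
    ∀ s ∈ (tmpl i sh : List (LStep (VN X Bd) (ZN X Bd) (B ⊕ XN X Bd n k))), SLin s := by
  intro s hs
  simp only [tmpl, List.mem_ofFn] at hs
  obtain ⟨l, rfl⟩ := hs
  exact instS_lin _ _

theorem tmpl_scnt {B X : Type} [Fintype X] {Bd n k : ℕ} (i : Fin (k + 1))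
    (sh : Fin n → Sh (VN X Bd) (ZN X Bd)) (d : B ⊕ XN X Bd n k) :
    ((tmpl i sh).map (scnt d)).sum ≤ if ∃ r, d = Sum.inr (i, r) then 1 else 0 := by
  have h1 : ((tmpl i sh).map (scnt d)).sum ≤
      ∑ r : RN X Bd n, ([Sum.inr (i, r)] : List (B ⊕ XN X Bd n k)).kcnt d := by
    rw [tmpl, List.map_ofFn, List.sum_ofFn, Fintype.sum_prod_type]
    exact Finset.sum_le_sum fun l _ => instS_scnt _ _ _
  refine h1.trans ?_
  simp only [List.kcnt_cons, List.kcnt_nil, zero_add]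
  split_ifs with h
  · obtain ⟨r, rfl⟩ := h
    simp
  · apply le_of_eq
    apply Finset.sum_eq_zero
    intro r _
    rw [if_neg]
    exact fun e => h ⟨r, e.symm⟩

theorem eval_tmpl {B X : Type} [Fintype X] {Bd n k : ℕ} (i : Fin (k + 1))
    (sh : Fin n → Sh (VN X Bd) (ZN X Bd)) (v : XN X Bd n k → List B) (c : VN X Bd) (z : ZN X Bd) :
    evalSubst v (lval (tmpl i sh) c z) =
      lval (List.ofFn fun l => instS (sh l) (fun P => v (i, (l, P)))) c z := by
  rw [evalSubst_eq, tmpl, lval_inst_flatMap]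
  simp

noncomputable def rootV {X : Type} {Bd : ℕ} (hB : 0 < Bd) (y : X) : VN X Bd :=
  fun x => if x = y then ⟨1, by omega⟩ else 0

noncomputable def decW {B X : Type} [Fintype X] {Bd n k : ℕ} (layer : X → Fin (k + 1))
    (st : Fin (k + 1) → Fin n → Sh (VN X Bd) (ZN X Bd)) (y : X) : List (B ⊕ XN X Bd n k) :=
  if hB : 0 < Bd then lval (tmpl (layer y) (st (layer y))) (rootV hB y) (y, ⟨0, hB⟩) else []

theorem decW_mem {B X : Type} [Fintype X] {Bd n k : ℕ} (layer : X → Fin (k + 1))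
    (st : Fin (k + 1) → Fin n → Sh (VN X Bd) (ZN X Bd)) (y : X) (d : B ⊕ XN X Bd n k)
    (hd : d ∈ decW layer st y) : ∃ r, d = Sum.inr (layer y, r) := by
  unfold decW at hd
  split_ifs at hd with hB
  · have h1 := scnt_of_mem_lval d _ _ _ hd
    have h2 := tmpl_scnt (layer y) (st (layer y)) d
    by_contra hne
    rw [if_neg hne] at h2
    omega
  · simp at hd

/-- Nodes that can be reached backwards from a single register. -/
def GoodN {A B : Type} (T : SST A B) {k : ℕ} (Bd : ℕ) (layer : T.X → Fin (k + 1)) (i : Fin (k + 1))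
    (q : T.Q) (c : VN T.X Bd) : Prop :=
  ∃ w p x0, layer x0 = i ∧ T.substFrom q w = some p ∧
    ∀ y, layer y = i → (c y : ℕ) ≤ (p.2 x0).kcnt (Sum.inr y)

def InvN {A B : Type} (T : SST A B) {k n : ℕ} (Bd : ℕ) (layer : T.X → Fin (k + 1))
    (q : T.Q) (v : T.X → List B) (st : Fin (k + 1) → Fin n → Sh (VN T.X Bd) (ZN T.X Bd))
    (v' : XN T.X Bd n k → List B) : Prop :=
  ∀ i c, GoodN T Bd layer i q c → ∀ (x : T.X) (j : Fin Bd), layer x = i → (j : ℕ) < (c x : ℕ) →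
    evalSubst v' (lval (tmpl i (st i)) c (x, j)) = v x

theorem bd_pos {A B : Type} (T : SST A B) {k : ℕ} (Bd : ℕ) (layer : T.X → Fin (k + 1))
    (hb : ∀ q w p, T.substFrom q w = some p → ∀ y : T.X,
        (∑ x ∈ Finset.univ.filter (fun x => layer x = layer y), occCount y (p.2 x)) ≤ Bd)
    (y : T.X) : 0 < Bd := by
  have h1 := hb T.q0 [] _ rfl y
  have h2 := Finset.single_le_sum (s := Finset.univ.filter (fun x => layer x = layer y))
    (f := fun x => occCount (B := B) y [Sum.inr x]) (a := y) (by simp) (by simp)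
  have h3 : occCount (B := B) y [Sum.inr y] = 1 := by
    simp [occCount_eq, List.kcnt_cons]
  have h4 : 1 ≤ Bd := by
    rw [← h3]
    exact h2.trans h1
  exact h4

theorem decW_eval {A B : Type} (T : SST A B) {k n : ℕ} (Bd : ℕ) (layer : T.X → Fin (k + 1))
    (hb : ∀ q w p, T.substFrom q w = some p → ∀ y : T.X,
        (∑ x ∈ Finset.univ.filter (fun x => layer x = layer y), occCount y (p.2 x)) ≤ Bd)
    (q : T.Q) (v : T.X → List B) (st : Fin (k + 1) → Fin n → Sh (VN T.X Bd) (ZN T.X Bd))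
    (v' : XN T.X Bd n k → List B) (hI : InvN T Bd layer q v st v') (y : T.X) :
    evalSubst v' (decW layer st y) = v y := by
  have hB := bd_pos T Bd layer hb y
  rw [decW, dif_pos hB]
  refine hI (layer y) _ ⟨[], _, y, rfl, rfl, ?_⟩ y _ rfl ?_
  · intro x _
    simp only [rootV, List.kcnt_cons]
    by_cases h : x = y
    · simp [h]
    · simp [h]
  · simp [rootV]

/-- Replace the registers outside layer `i` by their symbolic contents. -/
noncomputable def encW {B X : Type} [Fintype X] {Bd n k : ℕ} (layer : X → Fin (k + 1))
    (st : Fin (k + 1) → Fin n → Sh (VN X Bd) (ZN X Bd)) (i : Fin (k + 1)) (l : List (B ⊕ X)) :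
    List ((B ⊕ XN X Bd n k) ⊕ X) :=
  l.flatMap (Sum.elim (fun b => [Sum.inl (Sum.inl b)])
    (fun y => if layer y = i then [Sum.inr y] else (decW layer st y).map Sum.inl))

theorem encW_count {B X : Type} [Fintype X] {Bd n k : ℕ} (layer : X → Fin (k + 1))
    (st : Fin (k + 1) → Fin n → Sh (VN X Bd) (ZN X Bd)) (i : Fin (k + 1)) (l : List (B ⊕ X))
    (y : X) : (encW layer st i l).kcnt (Sum.inr y) =
      if layer y = i then l.kcnt (Sum.inr y) else 0 := by
  induction l with
  | nil => simp [encW]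
  | cons a l ih =>
    unfold encW at ih ⊢
    rw [List.flatMap_cons, List.kcnt_append, ih, List.kcnt_cons]
    cases a with
    | inl b => simp [List.kcnt_cons]
    | inr x =>
      by_cases hxy : x = y
      · subst hxy
        by_cases hx : layer x = i
        · simp [hx, List.kcnt_cons]; omega
        · simp [hx, List.kcnt_eq_zero]
      · by_cases hx : layer x = i
        · simp [hx, List.kcnt_cons, hxy]
        · have : ((decW layer st x).map (Sum.inl : B ⊕ XN X Bd n k → _ ⊕ X)).kcnt (Sum.inr y) = 0 := by
            rw [List.kcnt_eq_zero]; simp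
          simp [hx, hxy, this]

theorem encW_mem {B X : Type} [Fintype X] {Bd n k : ℕ} (layer : X → Fin (k + 1))
    (st : Fin (k + 1) → Fin n → Sh (VN X Bd) (ZN X Bd)) (i : Fin (k + 1)) (l : List (B ⊕ X))
    (hl : ∀ y, Sum.inr y ∈ l → layer y ≤ i) (j : Fin (k + 1)) (r : RN X Bd n)
    (h : Sum.inl (Sum.inr (j, r)) ∈ encW layer st i l) : j < i := by
  simp only [encW, List.mem_flatMap] at h
  obtain ⟨a, ha, h⟩ := h
  cases a with
  | inl b => simp at h
  | inr y =>
    by_cases hy : layer y = i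
    · simp [hy] at h
    · simp [hy] at h
      obtain ⟨r', hr⟩ := decW_mem layer st y _ h
      have : j = layer y := by
        have := Sum.inr.inj hr
        exact congrArg Prod.fst this
      rw [this]
      exact lt_of_le_of_ne (hl y ha) hy

theorem encW_eval {B X : Type} [Fintype X] {Bd n k : ℕ} (layer : X → Fin (k + 1))
    (st : Fin (k + 1) → Fin n → Sh (VN X Bd) (ZN X Bd)) (i : Fin (k + 1)) (l : List (B ⊕ X))
    (v : X → List B) (v' : XN X Bd n k → List B)
    (h : ∀ y, evalSubst v' (decW layer st y) = v y) :
    (encW layer st i l).flatMap (Sum.elim (Sum.elim (fun b => [b]) v') v) = evalSubst v l := by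
  induction l with
  | nil => rfl
  | cons a l ih =>
    unfold encW at ih ⊢
    rw [List.flatMap_cons, List.flatMap_append, ih]
    cases a with
    | inl b => simp [evalSubst_inl]
    | inr x =>
      rw [evalSubst_inr]
      congr 1
      by_cases hx : layer x = i
      · simp [hx]
      · rw [← h x, evalSubst_eq]
        simp [hx, List.flatMap_map]

/-- The parent of a node. -/
noncomputable def parentN {B X : Type} [Fintype X] {k : ℕ} (Bd : ℕ) (layer : X → Fin (k + 1))
    (i : Fin (k + 1)) (s : X → List (B ⊕ X)) (c : VN X Bd) : VN X Bd :=
  fun y => ⟨min Bd (∑ x, if layer x = i ∧ layer y = i then (c x : ℕ) * (s x).kcnt (Sum.inr y) else 0),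
    by omega⟩

theorem parentN_good {A B : Type} (T : SST A B) {k : ℕ} (Bd : ℕ) (layer : T.X → Fin (k + 1))
    (hb : ∀ q w p, T.substFrom q w = some p → ∀ y : T.X,
        (∑ x ∈ Finset.univ.filter (fun x => layer x = layer y), occCount y (p.2 x)) ≤ Bd)
    (q : T.Q) (a : A) (q' : T.Q) (s : T.X → List (B ⊕ T.X)) (ht : T.trans q a = some (q', s))
    (i : Fin (k + 1)) (c : VN T.X Bd) (hc : GoodN T Bd layer i q' c) :
    GoodN T Bd layer i q (parentN Bd layer i s c) ∧
    ∀ y, layer y = i →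
      (∑ x, if layer x = i then (c x : ℕ) * (s x).kcnt (Sum.inr y) else 0) ≤ Bd := by
  obtain ⟨w, p, x0, hx0, hw, hle⟩ := hc
  have hsub : T.substFrom q (a :: w) = some (p.1, fun x => applySubst s (p.2 x)) := by
    simp [SST.substFrom, ht, hw]
  have key : ∀ y, layer y = i →
      (∑ x, if layer x = i then (c x : ℕ) * (s x).kcnt (Sum.inr y) else 0) ≤
        (applySubst s (p.2 x0)).kcnt (Sum.inr y) := by
    intro y hy
    rw [count_applySubst_inr]
    apply Finset.sum_le_sum
    intro x _
    split_ifs with hx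
    · exact Nat.mul_le_mul_right _ (hle x hx)
    · exact Nat.zero_le _
  constructor
  · refine ⟨a :: w, _, x0, hx0, hsub, ?_⟩
    intro y hy
    refine le_trans ?_ (key y hy)
    simp [parentN, hy]
  · intro y hy
    refine (key y hy).trans ?_
    have h1 := hb q (a :: w) _ hsub y
    refine le_trans ?_ h1
    rw [← occCount_eq]
    exact Finset.single_le_sum (f := fun x => occCount y (applySubst s (p.2 x)))
      (a := x0) (by simp) (by simp [hx0, hy])

theorem layer_step {A B : Type} (T : SST A B) {k n : ℕ} (Bd : ℕ) (layer : T.X → Fin (k + 1))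
    (hn : Fintype.card (VN T.X Bd) ≤ n)
    (hm : ∀ q a p, T.trans q a = some p → ∀ x y, Sum.inr y ∈ p.2 x → layer y ≤ layer x)
    (hb : ∀ q w p, T.substFrom q w = some p → ∀ y : T.X,
        (∑ x ∈ Finset.univ.filter (fun x => layer x = layer y), occCount y (p.2 x)) ≤ Bd)
    (q : T.Q) (a : A) (q' : T.Q) (s : T.X → List (B ⊕ T.X)) (ht : T.trans q a = some (q', s))
    (st : Fin (k + 1) → Fin n → Sh (VN T.X Bd) (ZN T.X Bd)) (i : Fin (k + 1)) :
    ∃ (sh : Fin n → Sh (VN T.X Bd) (ZN T.X Bd)) (f : RN T.X Bd n → List (B ⊕ XN T.X Bd n k)),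
      (∀ r0, ∑ r, (f r).kcnt (Sum.inr (i, r0)) ≤ 1) ∧
      (∀ r j r0, Sum.inr (j, r0) ∈ f r → j ≤ i) ∧
      (∀ v v', InvN T Bd layer q v st v' → ∀ c, GoodN T Bd layer i q' c →
        ∀ (x : T.X) (j : Fin Bd), layer x = i → (j : ℕ) < (c x : ℕ) →
        lval (List.ofFn fun l => instS (sh l) (fun P => evalSubst v' (f (l, P)))) c (x, j) =
          evalSubst v (s x)) := by
  -- the words to be labelled
  let W : VN T.X Bd → ZN T.X Bd → List ((B ⊕ XN T.X Bd n k) ⊕ T.X) := fun c z =>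
    if layer z.1 = i ∧ (z.2 : ℕ) < (c z.1 : ℕ) then encW layer st i (s z.1) else []
  have hW := fun c => label_family Bd (W c)
  choose W' hW1 hW2 hW3 using hW
  let s0 : LStep (VN T.X Bd) (ZN T.X Bd) (B ⊕ XN T.X Bd n k) := ⟨parentN Bd layer i s, W'⟩
  have hs0 : SLin s0 := hW1
  have hWc : ∀ j r, i ≤ j → scnt (Sum.inr (j, r)) s0 = 0 := by
    intro j r hj
    unfold scnt
    apply Finset.sum_eq_zero
    intro c _
    apply Finset.sum_eq_zero
    intro z _
    show (W' c z).kcnt _ = 0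
    rw [hW2, List.kcnt_eq_zero]
    intro hmem
    simp only [W] at hmem
    split_ifs at hmem with hz
    · have := encW_mem layer st i (s z.1) (fun y hy => hz.1 ▸ hm q a _ ht z.1 y hy) j r hmem
      exact absurd this (not_lt.2 hj)
    · simp at hmem
  have hcount : ∀ c y, ∑ z, (W c z).kcnt (Sum.inr y) =
      if layer y = i then
        ∑ x, (if layer x = i then (c x : ℕ) * (s x).kcnt (Sum.inr y) else 0) else 0 := by
    intro c y
    rw [Fintype.sum_prod_type]
    have hx : ∀ x, ∑ j : Fin Bd, (W c (x, j)).kcnt (Sum.inr y) =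
        if layer y = i then (if layer x = i then (c x : ℕ) * (s x).kcnt (Sum.inr y) else 0)
        else 0 := by
      intro x
      have h1 : ∀ j : Fin Bd, (W c (x, j)).kcnt (Sum.inr y) =
          if (j : ℕ) < (c x : ℕ) then
            (if layer x = i then (if layer y = i then (s x).kcnt (Sum.inr y) else 0) else 0)
          else 0 := by
        intro j
        simp only [W]
        by_cases hx : layer x = i <;> by_cases hj : (j : ℕ) < (c x : ℕ) <;>
          simp [hx, hj, encW_count]
      simp only [h1]
      rw [← Finset.sum_filter, Finset.sum_const]
      have h2 : (Finset.univ.filter (fun j : Fin Bd => (j : ℕ) < (c x : ℕ))).card = (c x : ℕ) := by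
        rw [Fin.card_filter_val_lt]
        have := (c x).2
        omega
      rw [h2]
      split_ifs <;> simp
    simp only [hx]
    split_ifs <;> simp
  have hlin : ∀ x ∈ s0 :: tmpl i (st i), SLin x := by
    intro x hx
    rcases List.mem_cons.1 hx with rfl | hx
    · exact hs0
    · exact tmpl_lin _ _ _ hx
  obtain ⟨S', h1, h2, h3, h4⟩ := compress (s0 :: tmpl i (st i)) Finset.univ hlin
    (by simp [tmpl] at hn ⊢; omega)
  obtain ⟨sh, f, hf1, hf2⟩ := normalizeList n S' (by simp [tmpl] at h1; exact h1) h2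
  have hf3 : ∀ d, ∑ r : RN T.X Bd n, (f r.1 r.2).kcnt d ≤
      scnt d s0 + if ∃ r, d = Sum.inr (i, r) then 1 else 0 := by
    intro d
    rw [Fintype.sum_prod_type]
    refine (hf2 d).trans ((h3 d).trans ?_)
    simp only [List.map_cons, List.sum_cons]
    exact Nat.add_le_add_left (tmpl_scnt _ _ _) _
  refine ⟨sh, fun r => f r.1 r.2, ?_, ?_, ?_⟩
  · intro r0
    refine (hf3 _).trans ?_
    rw [hWc i r0 le_rfl]
    split_ifs <;> omega
  · intro r j r0 hmem
    by_contra hlt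
    rw [not_le] at hlt
    have hh := hf3 (Sum.inr (j, r0))
    rw [hWc j r0 hlt.le, if_neg] at hh
    · have h5 := Finset.single_le_sum (f := fun r : RN T.X Bd n => (f r.1 r.2).kcnt (Sum.inr (j, r0)))
        (by simp) (Finset.mem_univ r)
      exact absurd (lt_of_lt_of_le (List.kcnt_pos_iff.2 hmem) (h5.trans hh)) (lt_irrefl 0)
    · rintro ⟨r', hr'⟩
      have : j = i := congrArg Prod.fst (Sum.inr.inj hr')
      exact absurd this hlt.ne'
  · intro v v' hI c hc x j hx hj
    obtain ⟨hg, hle⟩ := parentN_good T Bd layer hb q a q' s ht i c hc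
    have e1 := lval_inst_flatMap (Sum.elim (fun b => [b]) v') n sh f c (x, j)
    simp only [← evalSubst_eq] at e1
    rw [← e1, hf1, h4 c (Finset.mem_univ c), evalSubst_eq]
    simp only [lval]
    rw [evalSubst_flatMap]
    have h5 : ∀ y, ∑ z, (W c z).kcnt (Sum.inr y) ≤ Bd := by
      intro y
      rw [hcount]
      split_ifs with hy
      · exact hle y hy
      · exact Nat.zero_le _
    have h6 := hW3 c (Sum.elim (fun b => [b]) v')
      (fun z => (lval (tmpl i (st i)) (parentN Bd layer i s c) z).flatMap
        (Sum.elim (fun b => [b]) v')) v h5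
      (by
        intro y j' hj'
        rw [hcount] at hj'
        split_ifs at hj' with hy
        · rw [← evalSubst_eq]
          refine hI i _ hg y j' hy ?_
          simp only [parentN, hy, and_true]
          exact lt_min j'.2 hj'
        · omega) (x, j)
    refine h6.trans ?_
    simp only [W, hx, hj, and_self, if_true]
    exact encW_eval layer st i (s x) v v' (decW_eval T Bd layer hb q v st v' hI)

theorem full_step {A B : Type} (T : SST A B) {k n : ℕ} (Bd : ℕ) (layer : T.X → Fin (k + 1))
    (hn : Fintype.card (VN T.X Bd) ≤ n)
    (hm : ∀ q a p, T.trans q a = some p → ∀ x y, Sum.inr y ∈ p.2 x → layer y ≤ layer x)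
    (hb : ∀ q w p, T.substFrom q w = some p → ∀ y : T.X,
        (∑ x ∈ Finset.univ.filter (fun x => layer x = layer y), occCount y (p.2 x)) ≤ Bd)
    (q : T.Q) (a : A) (st : Fin (k + 1) → Fin n → Sh (VN T.X Bd) (ZN T.X Bd)) :
    ∃ (st' : Fin (k + 1) → Fin n → Sh (VN T.X Bd) (ZN T.X Bd))
      (u : XN T.X Bd n k → List (B ⊕ XN T.X Bd n k)),
      ∀ q' s, T.trans q a = some (q', s) →
      (∀ x y, Sum.inr y ∈ u x → y.1 ≤ x.1) ∧
      (∀ y, (∑ x ∈ Finset.univ.filter (fun x : XN T.X Bd n k => x.1 = y.1),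
        occCount y (u x)) ≤ 1) ∧
      (∀ v v', InvN T Bd layer q v st v' →
        InvN T Bd layer q' (fun x => evalSubst v (s x)) st' (fun x => evalSubst v' (u x))) := by
  cases ht : T.trans q a with
  | none => exact ⟨st, fun _ => [], by simp⟩
  | some p =>
    obtain ⟨q', s⟩ := p
    have := fun i => layer_step T Bd layer hn hm hb q a q' s ht st i
    choose sh f h1 h2 h3 using this
    refine ⟨sh, fun x => f x.1 x.2, ?_⟩
    intro q'' s' he
    simp only [Option.some.injEq, Prod.mk.injEq] at he
    obtain ⟨rfl, rfl⟩ := he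
    refine ⟨?_, ?_, ?_⟩
    · intro x y hy
      exact h2 x.1 x.2 y.1 y.2 hy
    · rintro ⟨i, r0⟩
      simp only [occCount_eq]
      rw [Finset.sum_filter, Fintype.sum_prod_type, Finset.sum_eq_single i]
      · simpa using h1 i r0
      · intro j _ hj
        simp [hj]
      · simp
    · intro v v' hI i c hc x j hx hj
      rw [eval_tmpl]
      exact h3 i v v' hI c hc x j hx hj

theorem init_exists {A B : Type} (T : SST A B) {k n : ℕ} (Bd : ℕ) (layer : T.X → Fin (k + 1)) :
    ∃ (st : Fin (k + 1) → Fin (n + 1) → Sh (VN T.X Bd) (ZN T.X Bd))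
      (v' : XN T.X Bd (n + 1) k → List B), InvN T Bd layer T.q0 T.init st v' := by
  let s0 : LStep (VN T.X Bd) (ZN T.X Bd) B := ⟨id, fun _ z => (T.init z.1).map Sum.inl⟩
  have hs0 : SLin s0 := by
    intro c z'
    have : ∀ z, (s0.t c z).kcnt (Sum.inr z') = 0 := by
      intro z; rw [List.kcnt_eq_zero]; simp [s0]
    simp [this]
  obtain ⟨sh, f, h1, -⟩ := normalizeList (n + 1) (List.replicate (n + 1) s0) (by simp)
    (by intro s hs; rw [List.eq_of_mem_replicate hs]; exact hs0)
  refine ⟨fun _ => sh, fun x => f x.2.1 x.2.2, ?_⟩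
  intro i c _ x j _ _
  rw [eval_tmpl]
  show lval (List.ofFn fun l => instS (sh l) (f l)) c (x, j) = _
  rw [h1, List.replicate_succ]
  simp only [lval, s0, evalSubst_map_inl]

theorem layered_of_bounded {A B : Type} (T : SST A B) (k Bd : ℕ) (h : T.IsBounded k Bd) :
    ∃ T' : SST A B, T'.IsLayered k ∧ ∀ w, T'.eval w = T.eval w := by
  obtain ⟨layer, hm, hb⟩ := h
  let n := Fintype.card (VN T.X Bd)
  have hn : Fintype.card (VN T.X Bd) ≤ n + 1 := Nat.le_succ _
  obtain ⟨st0, v0, h0⟩ := init_exists T (n := n) Bd layer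
  have hstep := fun q a st => full_step T (n := n + 1) Bd layer hn hm hb q a st
  choose nst upd hu using hstep
  let T' : SST A B :=
    { Q := T.Q × (Fin (k + 1) → Fin (n + 1) → Sh (VN T.X Bd) (ZN T.X Bd))
      X := XN T.X Bd (n + 1) k
      q0 := (T.q0, st0)
      init := v0
      trans := fun q a => (T.trans q.1 a).map fun p => ((p.1, nst q.1 a q.2), upd q.1 a q.2)
      out := fun q => (T.out q.1).map fun o => o.flatMap (Sum.elim (fun b => [Sum.inl b])
        (decW layer q.2)) }
  refine ⟨T', ⟨fun x => x.1, ?_⟩, ?_⟩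
  · rintro ⟨q, st⟩ a p hp
    simp only [T', Option.map_eq_some_iff] at hp
    obtain ⟨⟨q', s⟩, ht, rfl⟩ := hp
    obtain ⟨h1, h2, -⟩ := hu q a st q' s ht
    exact ⟨h1, fun y => by convert h2 y⟩
  · have key : ∀ (w : List A) (q : T.Q) (v : T.X → List B)
        (st : Fin (k + 1) → Fin (n + 1) → Sh (VN T.X Bd) (ZN T.X Bd))
        (v' : XN T.X Bd (n + 1) k → List B), InvN T Bd layer q v st v' →
        ((T'.runFrom (q, st) v' w).bind fun p => (T'.out p.1).map fun o => evalSubst p.2 o) =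
        ((T.runFrom q v w).bind fun p => (T.out p.1).map fun o => evalSubst p.2 o) := by
      intro w
      induction w with
      | nil =>
        intro q v st v' hI
        simp only [SST.runFrom, Option.bind_some, T', Option.map_map]
        congr 1
        funext o
        simp only [Function.comp]
        rw [evalSubst_eq, List.flatMap_assoc, evalSubst_eq v]
        congr 1
        funext e
        cases e with
        | inl b => simp
        | inr y =>
          simp only [Sum.elim_inr]
          rw [← evalSubst_eq]
          exact decW_eval T Bd layer hb q v st v' hI y
      | cons a w ih =>
        intro q v st v' hI
        cases ht : T.trans q a with
        | none =>
          have ht' : T'.trans (q, st) a = none := by simp [T', ht]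
          simp only [SST.runFrom, ht, ht']
          rfl
        | some p =>
          obtain ⟨q', s⟩ := p
          have ht' : T'.trans (q, st) a = some ((q', nst q a st), upd q a st) := by simp [T', ht]
          simp only [SST.runFrom, ht, ht']
          exact ih _ _ _ _ ((hu q a st q' s ht).2.2 v v' hI)
    intro w
    exact key w T.q0 T.init st0 v0 h0

end LayerAux

theorem stmt17 {A B : Type} [Fintype A] [Fintype B] (T : SST A B) (k Bd : ℕ)
    (h : T.IsBounded k Bd) :
    ∃ T' : SST A B, T'.IsLayered k ∧ ∀ w, T'.eval w = T.eval w := by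
  exact layered_of_bounded T k Bd h
end
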